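/- arXiv:0809.0645 — 2 statements merged into one kernel-verified Lean document; each statement's English description precedes it below -/
import Mathlib

section
/- The automorphism group Aut(F₂) of the free group on 2 generators is isomorphic to the automorphism group Aut(B₄) of the braid group B₄ on 4 strings. -/
/-- The braid relations of `B₄ = ⟨a,b,c ∣ aba=bab, bcb=cbc, ac=ca⟩`. -/
def braidRels4 : Set (FreeGroup (Fin 3)) :=
  { FreeGroup.of 0 * FreeGroup.of 1 * FreeGroup.of 0 *
      (FreeGroup.of 1 * FreeGroup.of 0 * FreeGroup.of 1)⁻¹,
    FreeGroup.of 1 * FreeGroup.of 2 * FreeGroup.of 1 *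
      (FreeGroup.of 2 * FreeGroup.of 1 * FreeGroup.of 2)⁻¹,
    FreeGroup.of 0 * FreeGroup.of 2 * (FreeGroup.of 2 * FreeGroup.of 0)⁻¹ }

/-- The braid group on 4 strings. -/
abbrev B4 : Type := PresentedGroup braidRels4

def a : B4 := PresentedGroup.of 0
def b : B4 := PresentedGroup.of 1
def c : B4 := PresentedGroup.of 2

namespace FreeGroup

section CommonPrefix

variable {β : Type*} [DecidableEq β]

/-- The length of the longest common prefix of two lists. -/
def commonPrefixLength : List β → List β → ℕ
  | x :: l, y :: m => if x = y then commonPrefixLength l m + 1 else 0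
  | _, _ => 0

theorem min_commonPrefixLength_le (l k m : List β) :
    min (commonPrefixLength l k) (commonPrefixLength k m) ≤ commonPrefixLength l m := by
  induction k generalizing l m with
  | nil => simp [commonPrefixLength]
  | cons z k ih =>
    rcases l with _ | ⟨x, l⟩
    · simp [commonPrefixLength]
    rcases m with _ | ⟨y, m⟩
    · simp [commonPrefixLength]
    have := ih l m
    simp only [commonPrefixLength]
    split_ifs <;> first | omega | simp_all

theorem commonPrefixLength_comm (l m : List β) :
    commonPrefixLength l m = commonPrefixLength m l := by
  induction l generalizing m with
  | nil => cases m <;> simp [commonPrefixLength]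
  | cons x l ih =>
    rcases m with _ | ⟨y, m⟩
    · simp [commonPrefixLength]
    simp [commonPrefixLength, ih m, eq_comm]

theorem take_commonPrefixLength (l m : List β) :
    l.take (commonPrefixLength l m) = m.take (commonPrefixLength l m) := by
  induction l generalizing m with
  | nil => cases m <;> simp [commonPrefixLength]
  | cons x l ih =>
    rcases m with _ | ⟨y, m⟩
    · simp [commonPrefixLength]
    simp only [commonPrefixLength]
    split_ifs with h
    · simp [h, ih m]
    · simp

end CommonPrefix

variable {α : Type*} [DecidableEq α]

theorem norm_inv_mul_mk_add {l m : List (α × Bool)} (hl : IsReduced l) (hm : IsReduced m) :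
    norm ((mk l)⁻¹ * mk m) + 2 * commonPrefixLength l m = l.length + m.length := by
  induction l generalizing m with
  | nil =>
    simp [commonPrefixLength, norm, hm.reduce_eq, ← one_eq_mk]
  | cons x l ih =>
    rcases m with _ | ⟨y, m⟩
    · simp only [commonPrefixLength, ← one_eq_mk, mul_one, norm_inv_eq]
      simp [norm, hl.reduce_eq]
    by_cases h : x = y
    · subst h
      have := ih (hl.infix (List.suffix_cons x l).isInfix)
        (hm.infix (List.suffix_cons x m).isInfix)
      have e : (mk (x :: l))⁻¹ * mk (x :: m) = (mk l)⁻¹ * mk m := by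
        rw [← List.singleton_append, ← List.singleton_append (l := m), ← mul_mk, ← mul_mk]
        group
      rw [e]
      simp only [commonPrefixLength, if_true, List.length_cons]
      omega
    · have hr : IsReduced (invRev (x :: l) ++ y :: m) := by
        have hl' : IsReduced (invRev (x :: l)) := by
          rw [isReduced_iff_reduce_eq, reduce_invRev, hl.reduce_eq]
        refine List.isChain_append.2 ⟨hl', hm, ?_⟩
        simp only [invRev, List.map_cons, List.reverse_cons, List.getLast?_append,
          List.getLast?_singleton, List.head?_cons]
        rintro u hu v hv
        simp only [Option.mem_def, Option.some_or, Option.some.injEq] at hu hv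
        subst hu hv
        intro h1
        by_contra h2
        exact h (Prod.ext h1 (by revert h2; dsimp only; cases x.2 <;> cases y.2 <;> simp))
      rw [inv_mk, mul_mk, norm, toWord_mk, hr.reduce_eq]
      simp [commonPrefixLength, h]

/-- The length of the cancellation in the product `g⁻¹ * h` of elements of a free group. -/
def cancellation (g h : FreeGroup α) : ℕ := commonPrefixLength g.toWord h.toWord

theorem norm_inv_mul_add_cancellation (g h : FreeGroup α) :
    norm (g⁻¹ * h) + 2 * cancellation g h = norm g + norm h := by
  have := norm_inv_mul_mk_add (isReduced_toWord (x := g)) (isReduced_toWord (x := h))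
  rwa [mk_toWord, mk_toWord] at this

theorem cancellation_comm (g h : FreeGroup α) : cancellation g h = cancellation h g :=
  commonPrefixLength_comm _ _

theorem min_cancellation_le (g k h : FreeGroup α) :
    min (cancellation g k) (cancellation k h) ≤ cancellation g h :=
  min_commonPrefixLength_le _ _ _

theorem norm_lt_norm_mul_self {g : FreeGroup α} (hg : g ≠ 1) : norm g < norm (g * g) := by
  have key (n : ℕ) (hn : n ≠ 0) : norm (g ^ n) =
      2 * (reduceCyclically.conjugator g.toWord).length +
        n * (reduceCyclically g.toWord).length := by
    rw [norm, toWord_pow, reduceCyclically.reduce_flatten_replicate isReduced_toWord n, if_neg hn]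
    simp
    ring
  have h1 := key 1 one_ne_zero
  have h2 := key 2 two_ne_zero
  rw [pow_one] at h1
  rw [pow_two] at h2
  have : (reduceCyclically g.toWord).length ≠ 0 := by
    intro h0
    have h3 := reduceCyclically.conj_conjugator_reduceCyclically g.toWord
    rw [List.length_eq_zero_iff.1 h0] at h3
    apply hg
    rw [← mk_toWord (x := g), ← h3, List.append_nil, ← mul_mk, ← inv_mk, mul_inv_cancel]
  omega

/-- A homomorphism between free groups does not shorten words if the images of the letters
satisfy Nielsen's cancellation conditions. -/
theorem length_le_norm_of_nielsen {γ : Type*} (φ : FreeGroup γ →* FreeGroup α)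
    (h1 : ∀ s, 1 ≤ norm (φ (mk [s])))
    (h2 : ∀ s t, IsReduced [s, t] →
      2 * cancellation (φ (mk [s]))⁻¹ (φ (mk [t])) ≤ norm (φ (mk [t])))
    (h3 : ∀ s t r, IsReduced [s, t] → IsReduced [t, r] →
      cancellation (φ (mk [s]))⁻¹ (φ (mk [t])) + cancellation (φ (mk [t]))⁻¹ (φ (mk [r])) <
        norm (φ (mk [t])))
    (L : List (γ × Bool)) (hL : IsReduced L) : L.length ≤ norm (φ (mk L)) := by
  have key (L : List (γ × Bool)) (t : γ × Bool) (hL : IsReduced (t :: L)) (s : γ × Bool)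
      (hs : IsReduced [s, t]) :
      cancellation (φ (mk [s]))⁻¹ (φ (mk (t :: L))) = cancellation (φ (mk [s]))⁻¹ (φ (mk [t])) ∧
      L.length + 1 + cancellation (φ (mk [s]))⁻¹ (φ (mk [t])) ≤ norm (φ (mk (t :: L))) := by
    induction L generalizing t s with
    | nil =>
      have := h1 t
      have := h2 s t hs
      simp only [List.length_nil, true_and]
      omega
    | cons r L ih =>
      have htr : IsReduced [t, r] := hL.infix ⟨[], L, rfl⟩
      obtain ⟨e1, e2⟩ := ih r (hL.infix (List.suffix_cons _ _).isInfix) t htr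
      have hm : φ (mk (t :: r :: L)) = φ (mk [t]) * φ (mk (r :: L)) := by
        rw [← _root_.map_mul, mul_mk, List.singleton_append]
      have n1 := norm_inv_mul_add_cancellation (φ (mk [t]))⁻¹ (φ (mk (r :: L)))
      rw [inv_inv, ← hm, norm_inv_eq] at n1
      have n2 := norm_inv_mul_add_cancellation (φ (mk [t])) (φ (mk (t :: r :: L)))
      rw [hm, inv_mul_cancel_left, ← hm] at n2
      have n3 := h3 s t r hs htr
      have u1 := min_cancellation_le (φ (mk [s]))⁻¹ (φ (mk (t :: r :: L))) (φ (mk [t]))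
      have u2 := min_cancellation_le (φ (mk [s]))⁻¹ (φ (mk [t])) (φ (mk (t :: r :: L)))
      rw [cancellation_comm (φ (mk (t :: r :: L)))] at u1
      simp only [List.length_cons]
      omega
  rcases L with _ | ⟨t, L⟩
  · simp
  · have := (key L t hL t (by simp)).2
    simp only [List.length_cons]
    omega

/-- If `t` cancels one half each against the two sides in `s * t * s`, a conjugate of
`(s * t, t)` is shorter than `(s, t)`. -/
theorem exists_conj_norm_add_norm_lt {s t : FreeGroup α} (ht : t ≠ 1) {n : ℕ}
    (htn : norm t = 2 * n) (hst : norm t ≤ norm s) (h1 : n ≤ cancellation s⁻¹ t)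
    (h2 : n ≤ cancellation t⁻¹ s) :
    ∃ q, norm (q⁻¹ * (s * t) * q) + norm (q⁻¹ * t * q) < norm s + norm t := by
  have take_eq {g h : FreeGroup α} (hn : n ≤ cancellation g h) :
      g.toWord.take n = h.toWord.take n := by
    have := congrArg (List.take n) (take_commonPrefixLength g.toWord h.toWord)
    rwa [List.take_take, List.take_take, min_eq_left (show n ≤ commonPrefixLength _ _ from hn)]
      at this
  have e1 := take_eq h1
  have e2 := take_eq h2
  have drop_eq (g : FreeGroup α) :
      mk (g.toWord.drop (g.norm - n)) = (mk (g⁻¹.toWord.take n))⁻¹ := by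
    rw [toWord_inv, invRev, List.take_reverse, List.length_map, ← List.map_drop, inv_mk]
    simp [invRev, Function.comp_def, norm]
  set p := mk (t.toWord.take n) with hp
  set q := mk (s.toWord.take n) with hq
  have htpq : t = p * q⁻¹ := by
    have := drop_eq t
    rw [e2, ← hq, htn, show 2 * n - n = n by omega] at this
    rw [← this, hp, mul_mk, List.take_append_drop, mk_toWord]
  obtain ⟨W, hW, hs⟩ : ∃ W : List (α × Bool), W.length = norm s - 2 * n ∧ s = q * mk W * p⁻¹ := by
    refine ⟨(s.toWord.drop n).take (norm s - 2 * n), ?_, ?_⟩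
    · rw [List.length_take, List.length_drop, norm]; omega
    · have := drop_eq s
      rw [e1, ← hp] at this
      rw [← this, hq, mul_mk, mul_mk, List.append_assoc,
        show norm s - n = n + (norm s - 2 * n) by omega, ← List.drop_drop,
        List.take_append_drop, List.take_append_drop, mk_toWord]
  refine ⟨q, ?_⟩
  have a1 : q⁻¹ * (s * t) * q = mk W := by rw [htpq, hs]; group
  have a2 : q⁻¹ * t * q = q⁻¹ * p := by rw [htpq]; group
  have b1 : norm (mk W) ≤ norm s - 2 * n := hW ▸ norm_mk_le
  have b2 := norm_mul_le q⁻¹ p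
  have b3 : norm q ≤ n := norm_mk_le.trans (by simp)
  have b4 : norm p ≤ n := norm_mk_le.trans (by simp)
  have b5 : norm t ≠ 0 := by rwa [Ne, norm_eq_zero]
  rw [norm_inv_eq] at b2
  rw [a1, a2]
  omega

theorem inv_mk_singleton {α : Type*} {s t : α × Bool} (h1 : s.1 = t.1) (h2 : s.2 ≠ t.2) :
    (mk [s])⁻¹ = mk [t] := by
  rw [inv_mk]
  congr 1
  simp only [invRev, List.map_cons, List.map_nil, List.reverse_singleton, List.cons.injEq,
    and_true]
  exact Prod.ext h1 (by revert h2; dsimp only; cases s.2 <;> cases t.2 <;> simp)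

theorem mulAut_ext {δ ε : MulAut (FreeGroup (Fin 2))} (h0 : δ (of 0) = ε (of 0))
    (h1 : δ (of 1) = ε (of 1)) : δ = ε := by
  have : δ.toMonoidHom = ε.toMonoidHom := by
    ext i
    fin_cases i
    · exact h0
    · exact h1
  exact MulEquiv.toMonoidHom_injective this

/-- Nielsen's theorem in rank two: the automorphism group of the free group of rank two is
generated by the inner automorphisms and the elementary Nielsen transformations. -/
theorem nielsen_rank_two (G : Subgroup (MulAut (FreeGroup (Fin 2))))
    (hinner : ∀ q, MulAut.conj q ∈ G)
    {I P E : MulAut (FreeGroup (Fin 2))} (hI : I ∈ G) (hP : P ∈ G) (hE : E ∈ G)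
    (hI0 : I (of 0) = (of 0)⁻¹) (hI1 : I (of 1) = of 1)
    (hP0 : P (of 0) = of 1) (hP1 : P (of 1) = of 0)
    (hE0 : E (of 0) = of 0) (hE1 : E (of 1) = of 0 * of 1) : G = ⊤ := by
  rw [Subgroup.eq_top_iff']
  intro β
  let R : FreeGroup (Fin 2) → FreeGroup (Fin 2) → Prop := fun s t =>
    ∃ ν ∈ G, β (ν (of 0)) = s ∧ β (ν (of 1)) = t
  have Rswap {s t} : R s t → R t s := by
    rintro ⟨ν, h, rfl, rfl⟩
    exact ⟨ν * P, G.mul_mem h hP, by simp [hP0], by simp [hP1]⟩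
  have Rinv {s t} : R s t → R s⁻¹ t := by
    rintro ⟨ν, h, rfl, rfl⟩
    exact ⟨ν * I, G.mul_mem h hI, by simp [hI0], by simp [hI1]⟩
  have Rmul {s t} : R s t → R s (s * t) := by
    rintro ⟨ν, h, rfl, rfl⟩
    exact ⟨ν * E, G.mul_mem h hE, by simp [hE0], by simp [hE1]⟩
  have Rconj {s t} (q) : R s t → R (q * s * q⁻¹) (q * t * q⁻¹) := by
    rintro ⟨ν, h, rfl, rfl⟩
    exact ⟨MulAut.conj (β.symm q) * ν, G.mul_mem (hinner _) h, by simp, by simp⟩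
  have Rne {s t} : R s t → s ≠ 1 := by
    rintro ⟨ν, h, rfl, rfl⟩
    simp [of_ne_one]
  let M : FreeGroup (Fin 2) → FreeGroup (Fin 2) → Prop := fun s t =>
    R s t ∧ ∀ s' t', R s' t' → norm s + norm t ≤ norm s' + norm t'
  have Mswap {s t} (h : M s t) : M t s :=
    ⟨Rswap h.1, fun s' t' h' => by have := h.2 s' t' h'; omega⟩
  have Minv {s t} (h : M s t) : M s⁻¹ t :=
    ⟨Rinv h.1, fun s' t' h' => by rw [norm_inv_eq]; exact h.2 s' t' h'⟩
  have Minv' {s t} (h : M s t) : M s t⁻¹ := Mswap (Minv (Mswap h))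
  have Mle {s t} (h : M s t) : 2 * cancellation s⁻¹ t ≤ norm s ∧
      2 * cancellation s⁻¹ t ≤ norm t := by
    have h0 := norm_inv_mul_add_cancellation s⁻¹ t
    have h1 := h.2 _ _ (Rmul h.1)
    have h2 := (Mswap (Minv' (Minv h))).2 _ _ (Rmul (Mswap (Minv' (Minv h))).1)
    rw [← mul_inv_rev] at h2
    simp only [inv_inv, norm_inv_eq] at h0 h2
    omega
  have Mlt {s t} (h : M s t) : cancellation s⁻¹ t + cancellation t⁻¹ s < norm t := by
    by_contra! hc
    have h1 := Mle h
    have h2 := Mle (Mswap h)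
    obtain ⟨q, hq⟩ := exists_conj_norm_add_norm_lt (s := s) (t := t) (Rne (Rswap h.1))
      (n := cancellation s⁻¹ t) (by omega) (by omega) le_rfl (by omega)
    have h3 := Rconj (q⁻¹ * t⁻¹) (Rmul (Rswap h.1))
    rw [show q⁻¹ * t⁻¹ * t * (q⁻¹ * t⁻¹)⁻¹ = q⁻¹ * t * q by group,
      show q⁻¹ * t⁻¹ * (t * s) * (q⁻¹ * t⁻¹)⁻¹ = q⁻¹ * (s * t) * q by group] at h3
    have := h.2 _ _ h3
    omega
  have Msq {t : FreeGroup (Fin 2)} (ht : t ≠ 1) : 2 * cancellation t⁻¹ t < norm t := by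
    have h0 := norm_inv_mul_add_cancellation t⁻¹ t
    have := norm_lt_norm_mul_self ht
    rw [inv_inv, norm_inv_eq] at h0
    omega
  obtain ⟨ν, hν, hmin⟩ : ∃ ν ∈ G, M (β (ν (of 0))) (β (ν (of 1))) := by
    let S : Set (MulAut (FreeGroup (Fin 2))) := G
    let f : MulAut (FreeGroup (Fin 2)) → ℕ := fun ν =>
      norm (β (ν (of 0))) + norm (β (ν (of 1)))
    have hS : S.Nonempty := ⟨1, G.one_mem⟩
    refine ⟨Function.argminOn f S hS, Function.argminOn_mem f S hS,
      ⟨_, Function.argminOn_mem f S hS, rfl, rfl⟩, ?_⟩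
    rintro s' t' ⟨ν', h', rfl, rfl⟩
    exact Function.argminOn_le f S h'
  set γ : MulAut (FreeGroup (Fin 2)) := β * ν with hγ
  change M (γ (of 0)) (γ (of 1)) at hmin
  have hX (s t : Fin 2 × Bool) (hst : s.1 ≠ t.1) : M (γ (mk [s])) (γ (mk [t])) := by
    have hf (i : Fin 2) : mk [(i, false)] = (of i)⁻¹ := rfl
    have ht (i : Fin 2) : mk [(i, true)] = of i := rfl
    obtain ⟨i, e⟩ := s
    obtain ⟨j, f⟩ := t
    have h10 := Mswap hmin
    fin_cases i <;> fin_cases j <;> cases e <;> cases f <;>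
      simp [hf, ht] at hst ⊢ <;>
      first | exact hmin | exact Minv hmin | exact Minv' hmin | exact Minv (Minv' hmin) |
        exact h10 | exact Minv h10 | exact Minv' h10 | exact Minv (Minv' h10)
  have hX1 (s : Fin 2 × Bool) : mk [s] ≠ 1 := by
    intro h
    have := congrArg norm h
    simp [norm] at this
  have hXne (s : Fin 2 × Bool) : γ (mk [s]) ≠ 1 := by simpa using hX1 s
  have red {s t : Fin 2 × Bool} (h : IsReduced [s, t]) (h' : s.1 = t.1) : s = t := by
    have : s.1 = t.1 → s.2 = t.2 := by simpa [IsReduced] using h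
    exact Prod.ext h' (this h')
  have key (g : FreeGroup (Fin 2)) : norm g ≤ norm (γ g) := by
    have hle (s t : Fin 2 × Bool) (hst : IsReduced [s, t]) :
        2 * cancellation (γ (mk [s]))⁻¹ (γ (mk [t])) ≤ norm (γ (mk [s])) ∧
        2 * cancellation (γ (mk [s]))⁻¹ (γ (mk [t])) ≤ norm (γ (mk [t])) := by
      by_cases h : s.1 = t.1
      · obtain rfl := red hst h
        have := Msq (hXne s)
        omega
      · exact Mle (hX s t h)
    have := length_le_norm_of_nielsen γ.toMonoidHom
      (fun s => Nat.one_le_iff_ne_zero.2 (by simpa [norm_eq_zero] using hX1 s))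
      (fun s t hst => (hle s t hst).2)
      (fun s t r hst htr => ?_) g.toWord isReduced_toWord
    · rwa [mk_toWord] at this
    · have l1 := hle s t hst
      have l2 := hle t r htr
      change cancellation (γ (mk [s]))⁻¹ (γ (mk [t])) + cancellation (γ (mk [t]))⁻¹ (γ (mk [r])) <
        norm (γ (mk [t]))
      by_cases h : s.1 = t.1
      · obtain rfl := red hst h
        have := Msq (hXne s)
        omega
      by_cases h' : t.1 = r.1
      · obtain rfl := red htr h'
        have := Msq (hXne t)
        omega
      have hsr : s.1 = r.1 := by omega
      by_cases h2 : s.2 = r.2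
      · obtain rfl : s = r := Prod.ext hsr h2
        exact Mlt (hX s t h)
      · have hr : (γ (mk [s]))⁻¹ = γ (mk [r]) := by
          rw [← inv_mk_singleton hsr h2, _root_.map_inv]
        rw [hr] at l1 ⊢
        have u := min_cancellation_le (γ (mk [t]))⁻¹ (γ (mk [r])) (γ (mk [t]))
        have := Msq (hXne t)
        omega
  have hletter (i : Fin 2) : ∃ s, γ.symm (of i) = mk [s] := by
    have h1 := key (γ.symm (of i))
    have h2 : norm (γ.symm (of i)) ≠ 0 := by simp [norm_eq_zero, of_ne_one]
    rw [MulEquiv.apply_symm_apply, norm_of] at h1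
    obtain ⟨s, hs⟩ := List.length_eq_one_iff.1 (show (γ.symm (of i)).toWord.length = 1 by
      rw [norm] at h1 h2; omega)
    exact ⟨s, by rw [← hs, mk_toWord]⟩
  obtain ⟨s, hs⟩ := hletter 0
  obtain ⟨t, ht⟩ := hletter 1
  suffices h : γ.symm ∈ G by
    have h' := G.mul_mem (G.inv_mem h) (G.inv_mem hν)
    have : (γ.symm)⁻¹ * ν⁻¹ = β := by
      change γ * ν⁻¹ = β
      rw [hγ, mul_inv_cancel_right]
    rwa [this] at h'
  have hst : s.1 ≠ t.1 := by
    intro h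
    by_cases h' : s.2 = t.2
    · obtain rfl : s = t := Prod.ext h h'
      have := of_injective (γ.symm.injective (hs.trans ht.symm))
      simp at this
    · have h3 : γ.symm (of 0) = γ.symm (of 1)⁻¹ := by
        rw [_root_.map_inv, ht, hs, inv_mk_singleton h.symm (Ne.symm h')]
      have h4 := congrArg toWord (γ.symm.injective h3)
      simp [toWord_inv, invRev] at h4
  have hI' : P * I * P ∈ G := G.mul_mem (G.mul_mem hP hI) hP
  obtain ⟨i, e⟩ := s
  obtain ⟨j, f⟩ := t
  have hmem {ε : MulAut (FreeGroup (Fin 2))} (hε : ε ∈ G) (h0 : mk [(i, e)] = ε (of 0))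
      (h1 : mk [(j, f)] = ε (of 1)) : γ.symm ∈ G := by
    rwa [mulAut_ext (hs.trans h0) (ht.trans h1)]
  have hff (i : Fin 2) : mk [(i, false)] = (of i)⁻¹ := rfl
  have htt (i : Fin 2) : mk [(i, true)] = of i := rfl
  fin_cases i <;> fin_cases j <;> simp at hst
  · cases e <;> cases f
    · exact hmem (G.mul_mem hI hI') (by simp [*]) (by simp [*])
    · exact hmem hI (by simp [*]) (by simp [*])
    · exact hmem hI' (by simp [*]) (by simp [*])
    · exact hmem G.one_mem (by simp [*]) (by simp [*])
  · cases e <;> cases f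
    · exact hmem (G.mul_mem (G.mul_mem hI hI') hP) (by simp [*]) (by simp [*])
    · exact hmem (G.mul_mem hI' hP) (by simp [*]) (by simp [*])
    · exact hmem (G.mul_mem hI hP) (by simp [*]) (by simp [*])
    · exact hmem hP (by simp [*]) (by simp [*])

end FreeGroup

namespace PingPong

open Matrix MatrixGroups

/-- The matrices in `SL(2, ℤ)` whose first column has slope in the half-open arc `[1, ∞)`. -/
def arcOneInf : Set SL(2, ℤ) :=
  {g | (0 < g 1 0 ∧ g 1 0 ≤ g 0 0) ∨ (g 1 0 < 0 ∧ g 0 0 ≤ g 1 0)}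

/-- The matrices in `SL(2, ℤ)` whose first column has slope in the half-open arc `[∞, -1)`. -/
def arcInfNegOne : Set SL(2, ℤ) :=
  {g | g 1 0 = 0 ∨ (0 < g 1 0 ∧ g 0 0 < -g 1 0) ∨ (g 1 0 < 0 ∧ -g 1 0 < g 0 0)}

/-- The matrices in `SL(2, ℤ)` whose first column has slope in the half-open arc `[0, 1)`. -/
def arcZeroOne : Set SL(2, ℤ) :=
  {g | (0 < g 1 0 ∧ 0 ≤ g 0 0 ∧ g 0 0 < g 1 0) ∨ (g 1 0 < 0 ∧ g 1 0 < g 0 0 ∧ g 0 0 ≤ 0)}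

/-- The matrices in `SL(2, ℤ)` whose first column has slope in the half-open arc `[-1, 0)`. -/
def arcNegOneZero : Set SL(2, ℤ) :=
  {g | (0 < g 1 0 ∧ -g 1 0 ≤ g 0 0 ∧ g 0 0 < 0) ∨ (g 1 0 < 0 ∧ 0 < g 0 0 ∧ g 0 0 ≤ -g 1 0)}

theorem first_column_ne_zero (g : SL(2, ℤ)) : g 0 0 ≠ 0 ∨ g 1 0 ≠ 0 := by
  by_contra! h
  have := g.det_coe
  rw [det_fin_two, h.1, h.2] at this
  simp at this

/-- The matrices freely generating the commutator subgroup of `SL(2, ℤ)`. -/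
def hyperbolic : Fin 2 → SL(2, ℤ) :=
  ![⟨!![2, 1; 1, 1], by simp [det_fin_two]⟩, ⟨!![1, 1; 1, 2], by simp [det_fin_two]⟩]

/-- The matrices freely generating the Sanov subgroup of `SL(2, ℤ)`. -/
def sanov : Fin 2 → SL(2, ℤ) :=
  ![⟨!![1, 2; 0, 1], by simp [det_fin_two]⟩, ⟨!![1, 0; 2, 1], by simp [det_fin_two]⟩]

theorem mem_arcOneInf {g : SL(2, ℤ)} : g ∈ arcOneInf ↔
    (0 < g 1 0 ∧ g 1 0 ≤ g 0 0) ∨ (g 1 0 < 0 ∧ g 0 0 ≤ g 1 0) := Iff.rfl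

theorem mem_arcInfNegOne {g : SL(2, ℤ)} : g ∈ arcInfNegOne ↔
    g 1 0 = 0 ∨ (0 < g 1 0 ∧ g 0 0 < -g 1 0) ∨ (g 1 0 < 0 ∧ -g 1 0 < g 0 0) := Iff.rfl

theorem mem_arcZeroOne {g : SL(2, ℤ)} : g ∈ arcZeroOne ↔
    (0 < g 1 0 ∧ 0 ≤ g 0 0 ∧ g 0 0 < g 1 0) ∨ (g 1 0 < 0 ∧ g 1 0 < g 0 0 ∧ g 0 0 ≤ 0) := Iff.rfl

theorem mem_arcNegOneZero {g : SL(2, ℤ)} : g ∈ arcNegOneZero ↔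
    (0 < g 1 0 ∧ -g 1 0 ≤ g 0 0 ∧ g 0 0 < 0) ∨ (g 1 0 < 0 ∧ 0 < g 0 0 ∧ g 0 0 ≤ -g 1 0) := Iff.rfl

theorem first_column_mul (h g : SL(2, ℤ)) :
    (h * g) 0 0 = h 0 0 * g 0 0 + h 0 1 * g 1 0 ∧ (h * g) 1 0 = h 1 0 * g 0 0 + h 1 1 * g 1 0 := by
  simp [mul_apply, Fin.sum_univ_two]

theorem first_column_inv_mul (h g : SL(2, ℤ)) :
    (h⁻¹ * g) 0 0 = h 1 1 * g 0 0 - h 0 1 * g 1 0 ∧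
      (h⁻¹ * g) 1 0 = h 0 0 * g 1 0 - h 1 0 * g 0 0 := by
  rw [(first_column_mul _ _).1, (first_column_mul _ _).2, SpecialLinearGroup.SL2_inv_expl]
  simp
  constructor <;> ring

open scoped Pointwise in
theorem injective_lift_of_arcs {h : Fin 2 → SL(2, ℤ)} {Y : Fin 2 → Set SL(2, ℤ)}
    (hY : Y = ![arcNegOneZero, arcInfNegOne] ∨ Y = ![arcInfNegOne, arcNegOneZero])
    (h1 : ∀ i, h i • (Y i)ᶜ ⊆ ![arcOneInf, arcZeroOne] i)
    (h2 : ∀ i, (h i)⁻¹ • (![arcOneInf, arcZeroOne] i)ᶜ ⊆ Y i) :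
    Function.Injective (FreeGroup.lift h) := by
  refine FreeGroup.injective_lift_of_ping_pong h (α := SL(2, ℤ)) ![arcOneInf, arcZeroOne] Y
    ?_ ?_ ?_ ?_ h1 h2
  · intro i
    fin_cases i
    · exact ⟨⟨!![2, 1; 1, 1], by simp [det_fin_two]⟩, mem_arcOneInf.2 (by simp)⟩
    · exact ⟨⟨!![0, -1; 1, 0], by simp [det_fin_two]⟩, mem_arcZeroOne.2 (by simp)⟩
  · intro i j hij
    rw [Function.onFun, Set.disjoint_left]
    intro g
    fin_cases i <;> fin_cases j <;> simp [mem_arcOneInf, mem_arcZeroOne] at hij ⊢ <;> omega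
  · intro i j hij
    rw [Function.onFun, Set.disjoint_left]
    intro g
    rcases hY with rfl | rfl <;> fin_cases i <;> fin_cases j <;>
      simp [mem_arcNegOneZero, mem_arcInfNegOne] at hij ⊢ <;> omega
  · intro i j
    rw [Set.disjoint_left]
    intro g
    have := first_column_ne_zero g
    rcases hY with rfl | rfl <;> fin_cases i <;> fin_cases j <;>
      simp [mem_arcOneInf, mem_arcZeroOne, mem_arcNegOneZero, mem_arcInfNegOne] <;> omega

theorem injective_lift_hyperbolic : Function.Injective (FreeGroup.lift hyperbolic) := by
  refine injective_lift_of_arcs (Or.inl rfl) ?_ ?_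
  all_goals
    rintro i _ ⟨g, hg, rfl⟩
    have := first_column_ne_zero g
    have := first_column_mul (hyperbolic i) g
    have := first_column_inv_mul (hyperbolic i) g
    fin_cases i <;>
      simp only [mem_arcOneInf, mem_arcZeroOne, mem_arcNegOneZero, mem_arcInfNegOne,
        Set.mem_compl_iff, smul_eq_mul, Fin.zero_eta, Fin.mk_one, Matrix.cons_val_zero,
        Matrix.cons_val_one] at hg ⊢ <;>
      simp [hyperbolic, -SpecialLinearGroup.coe_mul] at * <;> omega

theorem injective_lift_sanov : Function.Injective (FreeGroup.lift sanov) := by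
  refine injective_lift_of_arcs (Or.inr rfl) ?_ ?_
  all_goals
    rintro i _ ⟨g, hg, rfl⟩
    have := first_column_ne_zero g
    have := first_column_mul (sanov i) g
    have := first_column_inv_mul (sanov i) g
    fin_cases i <;>
      simp only [mem_arcOneInf, mem_arcZeroOne, mem_arcNegOneZero, mem_arcInfNegOne,
        Set.mem_compl_iff, smul_eq_mul, Fin.zero_eta, Fin.mk_one, Matrix.cons_val_zero,
        Matrix.cons_val_one] at hg ⊢ <;>
      simp [sanov, -SpecialLinearGroup.coe_mul] at * <;> omega

open CongruenceSubgroup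

theorem mem_Gamma_iff_exists {m : ℕ} {g : SL(2, ℤ)} :
    g ∈ Gamma m ↔ ∃ X : Matrix (Fin 2) (Fin 2) ℤ,
      (g : Matrix (Fin 2) (Fin 2) ℤ) = 1 + (m : ℤ) • X := by
  have key (a e : ℤ) : (a : ZMod m) = e ↔ ∃ x, a = e + m * x := by
    rw [← sub_eq_zero, ← Int.cast_sub, ZMod.intCast_zmod_eq_zero_iff_dvd]
    exact exists_congr fun x => by rw [sub_eq_iff_eq_add']
  rw [Gamma_mem]
  have k1 := fun a => key a 1
  have k0 := fun a => key a 0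
  simp only [Int.cast_one, Int.cast_zero] at k1 k0
  rw [k1, k0, k0, k1]
  constructor
  · rintro ⟨⟨x, hx⟩, ⟨y, hy⟩, ⟨z, hz⟩, ⟨w, hw⟩⟩
    refine ⟨!![x, y; z, w], ?_⟩
    ext i j
    fin_cases i <;> fin_cases j <;> simp [*]
  · rintro ⟨X, hX⟩
    simp only [hX]
    exact ⟨⟨X 0 0, rfl⟩, ⟨X 0 1, rfl⟩, ⟨X 1 0, rfl⟩, ⟨X 1 1, rfl⟩⟩

theorem commutator_Gamma_le (m n : ℕ) : ⁅Gamma m, Gamma n⁆ ≤ Gamma (m * n) := by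
  rw [Subgroup.commutator_le]
  intro g hg h hh
  obtain ⟨X, hX⟩ := mem_Gamma_iff_exists.1 hg
  obtain ⟨Y, hY⟩ := mem_Gamma_iff_exists.1 hh
  set k := g⁻¹ * h⁻¹ with hk
  refine mem_Gamma_iff_exists.2 ⟨(X * Y - Y * X) * k, ?_⟩
  have e1 : g * h * g⁻¹ * h⁻¹ = g * h * k := by rw [hk]; group
  have e2 : (h * g) * k = 1 := by rw [hk]; group
  have e3 : (h : Matrix (Fin 2) (Fin 2) ℤ) * g * k = 1 := congrArg Subtype.val e2
  rw [commutatorElement_def, e1]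
  change (g : Matrix (Fin 2) (Fin 2) ℤ) * h * k = _
  rw [← e3, hX, hY]
  push_cast
  simp only [mul_add, add_mul, sub_mul, smul_sub, smul_mul_assoc, mul_smul_comm, one_mul,
    mul_one]
  module

/-- A free group of rank two is residually nilpotent: it has no nontrivial subgroup `N` contained
in the commutator of `N` with the whole group. -/
theorem eq_bot_of_le_commutator {N : Subgroup (FreeGroup (Fin 2))} (hN : N ≤ ⁅N, ⊤⁆) : N = ⊥ := by
  set S := FreeGroup.lift sanov
  have htop : (⊤ : Subgroup (FreeGroup (Fin 2))).map S ≤ Gamma 2 := by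
    rw [← MonoidHom.range_eq_map, FreeGroup.range_lift_eq_closure, Subgroup.closure_le]
    rintro _ ⟨i, rfl⟩
    fin_cases i <;> rw [SetLike.mem_coe, Gamma_mem] <;> simp [sanov] <;> decide
  have hpow (k : ℕ) : N.map S ≤ Gamma (2 ^ (k + 1)) := by
    induction k with
    | zero => simpa using (Subgroup.map_mono le_top).trans htop
    | succ k ih =>
      refine (Subgroup.map_mono hN).trans ?_
      rw [Subgroup.map_commutator]
      exact (Subgroup.commutator_mono ih htop).trans (commutator_Gamma_le _ _)
  rw [eq_bot_iff]
  intro w hw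
  apply injective_lift_sanov
  rw [map_one]
  have h0 (x : ℤ) (h : ∀ k : ℕ, ((2 ^ (k + 1) : ℕ) : ℤ) ∣ x) : x = 0 := by
    refine Int.eq_zero_of_abs_lt_dvd (h x.natAbs) ?_
    have := Nat.lt_two_pow_self (n := x.natAbs)
    push_cast
    rw [Int.abs_eq_natAbs, pow_succ]
    have h2 : (x.natAbs : ℤ) < 2 ^ x.natAbs := by exact_mod_cast this
    omega
  ext i j
  rw [← sub_eq_zero]
  refine h0 _ fun k => ?_
  obtain ⟨X, hX⟩ := mem_Gamma_iff_exists.1 (hpow k (Subgroup.mem_map_of_mem S hw))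
  exact ⟨X i j, by
    change (S w : Matrix (Fin 2) (Fin 2) ℤ) i j - (1 : Matrix (Fin 2) (Fin 2) ℤ) i j = _
    rw [hX]
    exact add_sub_cancel_left _ _⟩

end PingPong

namespace B4

open MatrixGroups
open Matrix hiding of mul_inv_rev
open FreeGroup (of lift_apply_of mulAut_ext norm_lt_norm_mul_self)

theorem a_mul_b_mul_a : a * b * a = b * a * b :=
  mul_inv_eq_one.1 (PresentedGroup.one_of_mem (rels := braidRels4) (Or.inl rfl))

theorem b_mul_c_mul_b : b * c * b = c * b * c :=
  mul_inv_eq_one.1 (PresentedGroup.one_of_mem (rels := braidRels4) (Or.inr (Or.inl rfl)))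

theorem a_mul_c : a * c = c * a :=
  mul_inv_eq_one.1 (PresentedGroup.one_of_mem (rels := braidRels4) (Or.inr (Or.inr rfl)))

theorem induction {p : B4 → Prop} (ha : p a) (hb : p b) (hc : p c) (one : p 1)
    (mul : ∀ g h, p g → p h → p (g * h)) (inv : ∀ g, p g → p g⁻¹) (g : B4) : p g := by
  have hg : g ∈ Subgroup.closure (Set.range (PresentedGroup.of (rels := braidRels4))) := by
    rw [PresentedGroup.closure_range_of]
    trivial
  induction hg using Subgroup.closure_induction with
  | mem x hx =>
    obtain ⟨i, rfl⟩ := hx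
    fin_cases i
    exacts [ha, hb, hc]
  | one => exact one
  | mul g h _ _ hg hh => exact mul g h hg hh
  | inv g _ hg => exact inv g hg

variable {G : Type*} [Group G]

/-- The homomorphism from the braid group determined by three elements satisfying the braid
relations. -/
def lift {s t u : G} (h1 : s * t * s = t * s * t) (h2 : t * u * t = u * t * u)
    (h3 : s * u = u * s) : B4 →* G :=
  PresentedGroup.toGroup (f := ![s, t, u]) <| by
    rintro r (rfl | rfl | rfl) <;> simp only [map_mul, map_inv, mul_inv_eq_one, lift_apply_of]
    exacts [h1, h2, h3]

section

variable {s t u : G} (h1 : s * t * s = t * s * t) (h2 : t * u * t = u * t * u)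
  (h3 : s * u = u * s)

@[simp] theorem lift_a : lift h1 h2 h3 a = s := PresentedGroup.toGroup.of _
@[simp] theorem lift_b : lift h1 h2 h3 b = t := PresentedGroup.toGroup.of _
@[simp] theorem lift_c : lift h1 h2 h3 c = u := PresentedGroup.toGroup.of _

end

theorem hom_ext {φ ψ : B4 →* G} (ha : φ a = ψ a) (hb : φ b = ψ b) (hc : φ c = ψ c) : φ = ψ := by
  refine PresentedGroup.ext fun i => ?_
  fin_cases i
  exacts [ha, hb, hc]

/-- The automorphism of the free group with the given values on generators of it and of its
inverse. -/
def autOfValues (v w : Fin 2 → FreeGroup (Fin 2))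
    (h1 : ∀ i, FreeGroup.lift w (v i) = of i) (h2 : ∀ i, FreeGroup.lift v (w i) = of i) :
    MulAut (FreeGroup (Fin 2)) :=
  MonoidHom.toMulEquiv (FreeGroup.lift v) (FreeGroup.lift w)
    (FreeGroup.ext_hom _ _ fun i => by simp [h1]) (FreeGroup.ext_hom _ _ fun i => by simp [h2])

@[simp] theorem autOfValues_of (v w : Fin 2 → FreeGroup (Fin 2)) (h1 h2) (i : Fin 2) :
    autOfValues v w h1 h2 (of i) = v i := lift_apply_of

/-- The image of `a` under the action of the braid group on the free group of rank two. -/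
def autA : MulAut (FreeGroup (Fin 2)) :=
  autOfValues ![of 0, of 0 * of 1] ![of 0, (of 0)⁻¹ * of 1]
    (by intro i; fin_cases i <;> simp) (by intro i; fin_cases i <;> simp)

/-- The image of `b` under the action of the braid group on the free group of rank two. -/
def autB : MulAut (FreeGroup (Fin 2)) :=
  autOfValues ![(of 1)⁻¹ * of 0, of 1] ![of 1 * of 0, of 1]
    (by intro i; fin_cases i <;> simp) (by intro i; fin_cases i <;> simp)

/-- The image of `c` under the action of the braid group on the free group of rank two. -/
def autC : MulAut (FreeGroup (Fin 2)) :=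
  autOfValues ![of 0, of 1 * of 0] ![of 0, of 1 * (of 0)⁻¹]
    (by intro i; fin_cases i <;> simp) (by intro i; fin_cases i <;> simp)

@[simp] theorem autA_zero : autA (of 0) = of 0 := autOfValues_of ..
@[simp] theorem autA_one : autA (of 1) = of 0 * of 1 := autOfValues_of ..
@[simp] theorem autB_zero : autB (of 0) = (of 1)⁻¹ * of 0 := autOfValues_of ..
@[simp] theorem autB_one : autB (of 1) = of 1 := autOfValues_of ..
@[simp] theorem autC_zero : autC (of 0) = of 0 := autOfValues_of ..
@[simp] theorem autC_one : autC (of 1) = of 1 * of 0 := autOfValues_of ..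

/-- The action of the braid group on the free group of rank two. -/
def action : B4 →* MulAut (FreeGroup (Fin 2)) :=
  lift (s := autA) (t := autB) (u := autC)
    (mulAut_ext (by simp) (by simp [mul_assoc]))
    (mulAut_ext (by simp [mul_assoc]) (by simp [mul_assoc]))
    (mulAut_ext (by simp) (by simp [mul_assoc]))

@[simp] theorem action_a : action a = autA := lift_a ..
@[simp] theorem action_b : action b = autB := lift_b ..
@[simp] theorem action_c : action c = autC := lift_c ..

/-- The normal free subgroup of rank two of the braid group, as a homomorphism. -/
def incl : FreeGroup (Fin 2) →* B4 :=
  FreeGroup.lift ![a * c⁻¹, a * b * c * (b * a * b)⁻¹]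

@[simp] theorem incl_zero : incl (of 0) = a * c⁻¹ := lift_apply_of
theorem incl_one : incl (of 1) = a * b * c * (b * a * b)⁻¹ := lift_apply_of

theorem a_mul_c_inv : a * c⁻¹ = c⁻¹ * a := (Commute.inv_right (show Commute a c from a_mul_c)).eq

theorem a_conj_b : a * b * a⁻¹ = b⁻¹ * a * b := by
  rw [mul_inv_eq_iff_eq_mul, mul_assoc b⁻¹, mul_assoc b⁻¹, eq_inv_mul_iff_mul_eq,
    ← mul_assoc, ← a_mul_b_mul_a, mul_assoc]

theorem c_conj_b : c⁻¹ * b * c = b * c * b⁻¹ := by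
  rw [eq_mul_inv_iff_mul_eq, mul_assoc, mul_assoc, inv_mul_eq_iff_eq_mul, ← mul_assoc, ← mul_assoc,
    b_mul_c_mul_b]

theorem b_conj_incl_zero : b * incl (of 0) * b⁻¹ = incl ((of 1)⁻¹ * of 0) := by
  rw [map_mul, eq_comm, map_inv, inv_mul_eq_iff_eq_mul, incl_zero, incl_one]
  calc a * c⁻¹ = a * (b * c * b⁻¹) * (c⁻¹ * b⁻¹) := by rw [← c_conj_b]; group
    _ = a * b * c * (b * a * b)⁻¹ * (b * (a * c⁻¹) * b⁻¹) := by group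

theorem b_mul_incl_one : b * incl (of 1) = incl (of 1) * b := by
  rw [incl_one]
  calc b * (a * b * c * (b * a * b)⁻¹) = (b * a * b) * c * (b * a * b)⁻¹ := by group
    _ = a * b * (a * c) * (a * b * a)⁻¹ := by rw [← a_mul_b_mul_a]; group
    _ = a * b * c * (b * a * b)⁻¹ * b := by rw [a_mul_c]; group

theorem incl_one_mul_a : incl (of 1) * a = c * incl (of 1) := by
  have h : c * a * b * c = a * b * c * b := by
    rw [← a_mul_c, mul_assoc, mul_assoc, ← mul_assoc c, ← b_mul_c_mul_b]; group
  rw [incl_one]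
  calc a * b * c * (b * a * b)⁻¹ * a = a * b * c * (a * b * a)⁻¹ * a := by rw [a_mul_b_mul_a]
    _ = (a * b * c * b) * (b⁻¹ * a⁻¹ * b⁻¹) := by group
    _ = c * (a * b * c * (b * a * b)⁻¹) := by rw [← h]; group

theorem conj_incl (g : B4) (f : FreeGroup (Fin 2)) : g * incl f * g⁻¹ = incl (action g f) := by
  have key (g : B4) (h : ∀ i, g * incl (of i) * g⁻¹ = incl (action g (of i)))
      (f : FreeGroup (Fin 2)) : g * incl f * g⁻¹ = incl (action g f) := by
    have : (MulAut.conj g).toMonoidHom.comp incl = incl.comp (action g).toMonoidHom :=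
      FreeGroup.ext_hom _ _ h
    exact DFunLike.congr_fun this f
  revert f
  induction g using B4.induction with
  | ha =>
    refine key a fun i => ?_
    fin_cases i
    · simp only [Fin.zero_eta, action_a, autA_zero, incl_zero]
      rw [mul_inv_eq_iff_eq_mul, mul_assoc, ← a_mul_c_inv]
    · simp only [Fin.mk_one, action_a, autA_one, map_mul, incl_zero]
      rw [mul_inv_eq_iff_eq_mul, mul_assoc, mul_assoc, incl_one_mul_a]
      group
  | hb =>
    refine key b fun i => ?_
    fin_cases i
    · simpa using b_conj_incl_zero
    · simp [b_mul_incl_one]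
  | hc =>
    refine key c fun i => ?_
    fin_cases i
    · simp [← mul_assoc, ← a_mul_c]
    · simp [← mul_assoc, incl_one_mul_a]
  | one => simp
  | mul g h hg hh =>
    intro f
    rw [map_mul, MulAut.mul_apply, ← hg, ← hh]
    group
  | inv g hg =>
    intro f
    have := hg (action g⁻¹ f)
    rw [← MulAut.mul_apply, ← map_mul, mul_inv_cancel, map_one, MulAut.one_apply] at this
    rw [← this]
    group

theorem action_incl (f : FreeGroup (Fin 2)) : action (incl f) = MulAut.conj f := by
  have h0 : action (a * c⁻¹) = MulAut.conj (of 0) := by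
    rw [map_mul, map_inv, mul_inv_eq_iff_eq_mul]
    exact mulAut_ext (by simp) (by simp [mul_assoc])
  have : action.comp incl = MulAut.conj := by
    refine FreeGroup.ext_hom _ _ fun i => ?_
    fin_cases i
    · simpa using h0
    · have h := b_conj_incl_zero
      rw [map_mul, map_inv, eq_inv_mul_iff_mul_eq, ← eq_mul_inv_iff_mul_eq] at h
      have h3 : action b * MulAut.conj (of 0) =
          MulAut.conj ((of 1)⁻¹ * of 0) * action b :=
        mulAut_ext (by simp [mul_assoc]) (by simp [mul_assoc])
      simp only [MonoidHom.comp_apply, Fin.mk_one, h, map_mul, map_inv, incl_zero, ← h0] at h3 ⊢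
      rw [h3]
      group
  exact DFunLike.congr_fun this f

theorem eq_one_of_conj_eq_one {f : FreeGroup (Fin 2)} (hf : MulAut.conj f = 1) : f = 1 := by
  have h (i : Fin 2) : f * of i = of i * f := by
    simpa [mul_inv_eq_iff_eq_mul] using DFunLike.congr_fun hf (of i)
  have hff : f * f = 1 := by
    apply PingPong.injective_lift_hyperbolic
    rw [map_mul, map_one]
    set A := FreeGroup.lift PingPong.hyperbolic f
    have hL (i : Fin 2) : A * PingPong.hyperbolic i = PingPong.hyperbolic i * A := by
      simpa using congrArg (FreeGroup.lift PingPong.hyperbolic) (h i)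
    have hA := A.det_coe
    rw [det_fin_two] at hA
    have key (i : Fin 2) : (A * PingPong.hyperbolic i : Matrix (Fin 2) (Fin 2) ℤ) =
      PingPong.hyperbolic i * A := congrArg Subtype.val (hL i)
    have e0 := fun i j => congrFun (congrFun (key 0) i) j
    have e1 := fun i j => congrFun (congrFun (key 1) i) j
    simp [PingPong.hyperbolic, mul_apply, Fin.sum_univ_two, Fin.forall_fin_two] at e0 e1
    have h1 : A 0 1 = 0 := by omega
    have h2 : A 1 0 = 0 := by omega
    have h3 : A 1 1 = A 0 0 := by omega
    ext i j
    rw [h1, h2, h3] at hA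
    fin_cases i <;> fin_cases j <;> simp [mul_apply, Fin.sum_univ_two, h1, h2, h3] <;> linarith
  by_contra hne
  have := norm_lt_norm_mul_self hne
  simp [hff] at this

theorem incl_injective : Function.Injective incl :=
  (injective_iff_map_eq_one _).2 fun f hf =>
    eq_one_of_conj_eq_one (by rw [← action_incl, hf, map_one])

/-- The abelianization of the braid group. -/
def expSum : B4 →* Multiplicative ℤ :=
  lift (s := .ofAdd 1) (t := .ofAdd 1) (u := .ofAdd 1) rfl rfl rfl

@[simp] theorem expSum_a : expSum a = .ofAdd 1 := lift_a ..
@[simp] theorem expSum_b : expSum b = .ofAdd 1 := lift_b ..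
@[simp] theorem expSum_c : expSum c = .ofAdd 1 := lift_c ..

theorem hom_eq_zpow_expSum {A : Type*} [CommGroup A] (ψ : B4 →* A) (g : B4) :
    ψ g = ψ a ^ (expSum g).toAdd := by
  have hab : ψ a = ψ b := by
    have := congrArg ψ a_mul_b_mul_a
    simp only [map_mul] at this
    rwa [mul_comm (ψ a) (ψ b), mul_right_inj] at this
  have hbc : ψ b = ψ c := by
    have := congrArg ψ b_mul_c_mul_b
    simp only [map_mul] at this
    rwa [mul_comm (ψ b) (ψ c), mul_right_inj] at this
  have : ψ = (zpowersHom A (ψ a)).comp expSum :=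
    hom_ext (by simp) (by simp [hab]) (by simp [hab, hbc])
  simpa using DFunLike.congr_fun this g

theorem expSum_incl (f : FreeGroup (Fin 2)) : expSum (incl f) = 1 := by
  have : expSum.comp incl = 1 := by
    refine FreeGroup.ext_hom _ _ fun i => ?_
    fin_cases i
    · simp
    · simp [incl_one]
  exact DFunLike.congr_fun this f

/-- The image of `b` in `SL(2, ℤ)`; that of `a` and `c` is `ModularGroup.T`. -/
def matB : SL(2, ℤ) := ⟨!![1, 0; -1, 1], by simp⟩

theorem coe_matB : (matB : Matrix (Fin 2) (Fin 2) ℤ) = !![1, 0; -1, 1] := rfl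

/-- The action of the braid group on the abelianization of the free group of rank two. -/
def toSL : B4 →* SL(2, ℤ) :=
  lift (s := ModularGroup.T) (t := matB) (u := ModularGroup.T) (by decide) (by decide) rfl

@[simp] theorem toSL_a : toSL a = ModularGroup.T := lift_a ..
@[simp] theorem toSL_b : toSL b = matB := lift_b ..
@[simp] theorem toSL_c : toSL c = ModularGroup.T := lift_c ..

/-- The exponent sums of a word in the free group of rank two. -/
def expSums : FreeGroup (Fin 2) →* Multiplicative (Fin 2 → ℤ) :=
  FreeGroup.lift fun i => .ofAdd (Pi.single i 1)

theorem expSums_action (g : B4) (f : FreeGroup (Fin 2)) :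
    (expSums (action g f)).toAdd = (toSL g : Matrix (Fin 2) (Fin 2) ℤ) *ᵥ (expSums f).toAdd := by
  have key (g : B4) (h : ∀ i, (expSums (action g (of i))).toAdd =
      (toSL g : Matrix (Fin 2) (Fin 2) ℤ) *ᵥ (expSums (of i)).toAdd) (f : FreeGroup (Fin 2)) :
      (expSums (action g f)).toAdd =
        (toSL g : Matrix (Fin 2) (Fin 2) ℤ) *ᵥ (expSums f).toAdd := by
    have : expSums.comp (action g).toMonoidHom =
        (AddMonoidHom.toMultiplicative (mulVecLin (toSL g).1).toAddMonoidHom).comp expSums :=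
      FreeGroup.ext_hom _ _ h
    exact DFunLike.congr_fun this f
  revert f
  induction g using B4.induction with
  | ha =>
    refine key a fun i => ?_
    ext j
    fin_cases i <;> fin_cases j <;> simp [expSums, ModularGroup.coe_T]
  | hb =>
    refine key b fun i => ?_
    ext j
    fin_cases i <;> fin_cases j <;> simp [expSums, coe_matB]
  | hc =>
    refine key c fun i => ?_
    ext j
    fin_cases i <;> fin_cases j <;> simp [expSums, ModularGroup.coe_T]
  | one => simp
  | mul g h hg hh =>
    intro f
    rw [map_mul, MulAut.mul_apply, hg, hh, map_mul, mulVec_mulVec]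
    rfl
  | inv g hg =>
    intro f
    have h1 := hg (action g⁻¹ f)
    rw [← MulAut.mul_apply, ← map_mul, mul_inv_cancel, map_one, MulAut.one_apply] at h1
    have h2 : (toSL g⁻¹ : Matrix (Fin 2) (Fin 2) ℤ) * toSL g = 1 :=
      congrArg Subtype.val (show toSL g⁻¹ * toSL g = 1 by rw [← map_mul, inv_mul_cancel, map_one])
    rw [h1, mulVec_mulVec, h2, one_mulVec]

theorem toSL_eq_one_of_action_eq_one {g : B4} (hg : action g = 1) : toSL g = 1 := by
  have h (i : Fin 2) := expSums_action g (of i)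
  simp only [hg, MulAut.one_apply, expSums, lift_apply_of, toAdd_ofAdd, mulVec_single_one] at h
  ext i j
  have := congrFun (h j) i
  rw [Matrix.col_apply] at this
  rw [← this]
  exact (Pi.single_apply j (1 : ℤ) i).trans (one_apply (i := i) (j := j)).symm

theorem toSL_incl (f : FreeGroup (Fin 2)) : toSL (incl f) = 1 := by
  have : toSL.comp incl = 1 := by
    refine FreeGroup.ext_hom _ _ fun i => ?_
    fin_cases i
    · simp only [MonoidHom.comp_apply, Fin.zero_eta, incl_zero, map_mul, map_inv]
      exact mul_inv_cancel (toSL a)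
    · simp [incl_one]
      decide
  exact DFunLike.congr_fun this f

/-- A section over the commutator subgroup of `SL(2, ℤ)`. -/
def slSection : FreeGroup (Fin 2) →* B4 := FreeGroup.lift ![a * b⁻¹, b⁻¹ * a]

theorem slSection_zero : slSection (of 0) = a * b⁻¹ := lift_apply_of
theorem slSection_one : slSection (of 1) = b⁻¹ * a := lift_apply_of

theorem toSL_slSection (w : FreeGroup (Fin 2)) :
    toSL (slSection w) = FreeGroup.lift PingPong.hyperbolic w := by
  have : toSL.comp slSection = FreeGroup.lift PingPong.hyperbolic := by
    refine FreeGroup.ext_hom _ _ fun i => ?_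
    fin_cases i
    · simp only [MonoidHom.comp_apply, Fin.zero_eta, slSection_zero, map_mul, map_inv, toSL_a,
        toSL_b, lift_apply_of]
      decide
    · simp only [MonoidHom.comp_apply, Fin.mk_one, slSection_one, map_mul, map_inv, toSL_a,
        toSL_b, lift_apply_of]
      decide
  exact DFunLike.congr_fun this w

theorem expSum_slSection (w : FreeGroup (Fin 2)) : expSum (slSection w) = 1 := by
  have : expSum.comp slSection = 1 := by
    refine FreeGroup.ext_hom _ _ fun i => ?_
    fin_cases i
    · simp [slSection_zero]
    · simp [slSection_one]
  exact DFunLike.congr_fun this w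

theorem a_conj_slSection (w : FreeGroup (Fin 2)) : a * slSection w * a⁻¹ =
    slSection (FreeGroup.lift ![of 0 * (of 1)⁻¹, of 0] w) := by
  have : (MulAut.conj a).toMonoidHom.comp slSection =
      slSection.comp (FreeGroup.lift ![of 0 * (of 1)⁻¹, of 0]) := by
    refine FreeGroup.ext_hom _ _ fun i => ?_
    fin_cases i
    · have h : a * b⁻¹ * a⁻¹ = b⁻¹ * a⁻¹ * b := by
        simpa [mul_assoc] using congrArg (·⁻¹) a_conj_b
      simp [slSection_zero, slSection_one, mul_assoc] at h ⊢
      exact h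
    · simp [slSection_zero, slSection_one, mul_assoc]
  exact DFunLike.congr_fun this w

theorem a_inv_conj_slSection (w : FreeGroup (Fin 2)) : a⁻¹ * slSection w * a =
    slSection (FreeGroup.lift ![of 1, (of 0)⁻¹ * of 1] w) := by
  have : (MulAut.conj a⁻¹).toMonoidHom.comp slSection =
      slSection.comp (FreeGroup.lift ![of 1, (of 0)⁻¹ * of 1]) := by
    refine FreeGroup.ext_hom _ _ fun i => ?_
    fin_cases i
    · simp [slSection_zero, slSection_one]
    · have h : a⁻¹ * b⁻¹ * a = b * a⁻¹ * b⁻¹ := by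
        calc a⁻¹ * b⁻¹ * a = a⁻¹ * (b⁻¹ * a * b) * b⁻¹ := by group
          _ = b * a⁻¹ * b⁻¹ := by rw [← a_conj_b]; group
      calc a⁻¹ * slSection (of 1) * a⁻¹⁻¹ = a⁻¹ * b⁻¹ * a * a := by rw [slSection_one]; group
        _ = slSection ((of 0)⁻¹ * of 1) := by
          rw [h, map_mul, map_inv, slSection_zero, slSection_one]; group
        _ = _ := by simp
  simpa using DFunLike.congr_fun this w

theorem exists_decomposition (g : B4) : ∃ f w, ∃ n : ℤ, g = incl f * slSection w * a ^ n := by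
  set S : Set B4 := {g | ∃ f w, ∃ n : ℤ, g = incl f * slSection w * a ^ n}
  have hf (f : FreeGroup (Fin 2)) {g : B4} : g ∈ S → incl f * g ∈ S := by
    rintro ⟨f', w, n, rfl⟩
    exact ⟨f * f', w, n, by simp [mul_assoc]⟩
  have hw (w : FreeGroup (Fin 2)) {g : B4} : g ∈ S → slSection w * g ∈ S := by
    rintro ⟨f, w', n, rfl⟩
    refine ⟨action (slSection w) f, w * w', n, ?_⟩
    rw [← conj_incl, map_mul]
    group
  have ha {g : B4} : g ∈ S → a * g ∈ S := by
    rintro ⟨f, w, n, rfl⟩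
    refine ⟨action a f, FreeGroup.lift ![of 0 * (of 1)⁻¹, of 0] w, n + 1, ?_⟩
    rw [← conj_incl, ← a_conj_slSection w]
    group
  have ha' {g : B4} : g ∈ S → a⁻¹ * g ∈ S := by
    rintro ⟨f, w, n, rfl⟩
    refine ⟨action a⁻¹ f, FreeGroup.lift ![of 1, (of 0)⁻¹ * of 1] w, n - 1, ?_⟩
    rw [← conj_incl, ← a_inv_conj_slSection w]
    group
  suffices h : (∀ h ∈ S, g * h ∈ S) ∧ ∀ h ∈ S, g⁻¹ * h ∈ S by
    have := h.1 1 ⟨1, 1, 0, by simp⟩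
    rwa [mul_one] at this
  induction g using B4.induction with
  | ha => exact ⟨fun _ => ha, fun _ => ha'⟩
  | hb =>
    refine ⟨fun h hh => ?_, fun h hh => ?_⟩
    · convert hw (of 0)⁻¹ (ha hh) using 1
      rw [map_inv, slSection_zero]
      group
    · convert ha' (hw (of 0) hh) using 1
      rw [slSection_zero]
      group
  | hc =>
    refine ⟨fun h hh => ?_, fun h hh => ?_⟩
    · convert hf (of 0)⁻¹ (ha hh) using 1
      rw [map_inv, incl_zero]
      group
    · convert ha' (hf (of 0) hh) using 1
      rw [incl_zero]
      group
  | one => simp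
  | mul g h hg hh =>
    refine ⟨fun k hk => ?_, fun k hk => ?_⟩
    · rw [mul_assoc]
      exact hg.1 _ (hh.1 _ hk)
    · rw [mul_inv_rev, mul_assoc]
      exact hh.2 _ (hg.2 _ hk)
  | inv g hg => exact ⟨hg.2, by simpa using hg.1⟩

theorem exists_of_mem_ker {g : B4} (hg : expSum g = 1) :
    ∃ f w, g = incl f * slSection w := by
  obtain ⟨f, w, n, rfl⟩ := exists_decomposition g
  have hn : n = 0 := by
    simpa [expSum_incl, expSum_slSection, ← ofAdd_zsmul] using hg
  exact ⟨f, w, by simp [hn]⟩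

theorem mem_range_incl {g : B4} (hg : expSum g = 1) (h : toSL g = 1) : g ∈ incl.range := by
  obtain ⟨f, w, rfl⟩ := exists_of_mem_ker hg
  rw [map_mul, toSL_incl, one_mul, toSL_slSection] at h
  rw [(injective_iff_map_eq_one _).1 PingPong.injective_lift_hyperbolic w h]
  exact ⟨f, by simp⟩

theorem eq_one_of_action_eq_one {g : B4} (hg : expSum g = 1) (h : action g = 1) : g = 1 := by
  obtain ⟨f, rfl⟩ := mem_range_incl hg (toSL_eq_one_of_action_eq_one h)
  rw [action_incl] at h
  rw [eq_one_of_conj_eq_one h, map_one]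

/-- The lift to integral matrices of a homomorphism from `SL(2, ℤ)` onto `ℤ/3ℤ`. -/
def modThree (A : SL(2, ℤ)) : ZMod 3 :=
  (1 - (A 1 0 : ZMod 3) ^ 2) * A 0 1 * A 1 1 + A 1 0 * (A 0 0 + A 1 1)

theorem modThree_mul_toSL (A : SL(2, ℤ)) (g : B4) :
    modThree (A * toSL g) = modThree A + (expSum g).toAdd := by
  have hA (A : SL(2, ℤ)) : (A 0 0 : ZMod 3) * A 1 1 - A 0 1 * A 1 0 = 1 := by
    have := A.det_coe
    rw [det_fin_two] at this
    exact_mod_cast congrArg (Int.cast (R := ZMod 3)) this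
  have hmul (A B : SL(2, ℤ)) (i j : Fin 2) :
      (A * B) i j = A i 0 * B 0 j + A i 1 * B 1 j := by
    simp [mul_apply, Fin.sum_univ_two]
  have hT (A : SL(2, ℤ)) : modThree (A * ModularGroup.T) = modThree A + 1 := by
    have := hA A
    simp only [modThree, hmul, ModularGroup.coe_T]
    simp
    generalize (A 0 0 : ZMod 3) = p, (A 0 1 : ZMod 3) = q, (A 1 0 : ZMod 3) = r,
      (A 1 1 : ZMod 3) = s at *
    revert p q r s
    decide
  have hU (A : SL(2, ℤ)) : modThree (A * matB) = modThree A + 1 := by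
    have := hA A
    simp only [modThree, hmul, coe_matB]
    simp
    generalize (A 0 0 : ZMod 3) = p, (A 0 1 : ZMod 3) = q, (A 1 0 : ZMod 3) = r,
      (A 1 1 : ZMod 3) = s at *
    revert p q r s
    decide
  revert A
  induction g using B4.induction with
  | ha => simpa using hT
  | hb => simpa using hU
  | hc => simpa using hT
  | one => simp
  | mul g h hg hh =>
    intro A
    rw [map_mul, ← mul_assoc, hh, hg, map_mul, toAdd_mul, Int.cast_add, add_assoc]
  | inv g hg =>
    intro A
    have := hg (A * toSL g⁻¹)
    rw [mul_assoc, ← map_mul, inv_mul_cancel, map_one, mul_one] at this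
    rw [this, map_inv expSum, toAdd_inv, Int.cast_neg, add_neg_cancel_right]

theorem three_dvd_expSum {g : B4} (hg : toSL g = 1) : 3 ∣ (expSum g).toAdd := by
  have := modThree_mul_toSL 1 g
  rw [hg, mul_one, left_eq_add] at this
  exact (ZMod.intCast_zmod_eq_zero_iff_dvd _ 3).1 this

instance normal_range_incl : incl.range.Normal where
  conj_mem := by
    rintro _ ⟨f, rfl⟩ g
    exact ⟨_, (conj_incl g f).symm⟩

theorem range_incl_le_ker : incl.range ≤ expSum.ker := by
  rintro _ ⟨f, rfl⟩
  exact expSum_incl f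

theorem range_incl_le_commutator : incl.range ≤ ⁅incl.range, expSum.ker⁆ := by
  have key (g : B4) (hg : expSum g = 1) (f : FreeGroup (Fin 2)) :
      incl (action g f * f⁻¹) ∈ ⁅incl.range, expSum.ker⁆ := by
    rw [Subgroup.commutator_comm, map_mul, ← conj_incl, map_inv]
    exact Subgroup.commutator_mem_commutator hg ⟨f, rfl⟩
  have hB (f : FreeGroup (Fin 2)) : action b⁻¹ f = autB.symm f := by
    rw [map_inv, action_b]
    rfl
  have hB0 : autB.symm (of 0) = of 1 * of 0 := by simp [MulEquiv.symm_apply_eq]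
  have h1 : incl (of 1) ∈ ⁅incl.range, expSum.ker⁆ := by
    simpa [hB, hB0] using key (b⁻¹ * a) (by simp) (of 0)
  have h0 : incl (of 0) ∈ ⁅incl.range, expSum.ker⁆ := by
    have := key (a * b⁻¹) (by simp) (of 0)
    rw [map_mul action, MulAut.mul_apply, hB, hB0, action_a, map_mul autA, autA_one, autA_zero,
      mul_inv_cancel_right, map_mul] at this
    exact (Subgroup.mul_mem_cancel_right _ h1).1 this
  have hgen : incl.range = Subgroup.closure (Set.range fun i => incl (of i)) := by
    rw [← FreeGroup.range_lift_eq_closure]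
    congr 1
    exact FreeGroup.ext_hom _ _ fun i => by simp
  nth_rewrite 1 [hgen]
  rw [Subgroup.closure_le]
  rintro _ ⟨i, rfl⟩
  fin_cases i
  exacts [h0, h1]

theorem map_ker_expSum_le (φ : MulAut B4) : expSum.ker.map φ.toMonoidHom ≤ expSum.ker := by
  rintro _ ⟨g, hg, rfl⟩
  have := hom_eq_zpow_expSum (expSum.comp φ.toMonoidHom) g
  rw [show expSum g = 1 from hg, toAdd_one, zpow_zero] at this
  exact this

theorem map_toSL_ker_expSum_le :
    expSum.ker.map toSL ≤ (FreeGroup.lift PingPong.hyperbolic).range := by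
  rintro _ ⟨g, hg, rfl⟩
  obtain ⟨f, w, rfl⟩ := exists_of_mem_ker hg
  exact ⟨w, by rw [map_mul, toSL_incl, toSL_slSection, one_mul]⟩

theorem map_range_incl_le (φ : MulAut B4) : incl.range.map φ.toMonoidHom ≤ incl.range := by
  set F := incl.range.map φ.toMonoidHom
  set L := FreeGroup.lift PingPong.hyperbolic
  have hF : F ≤ expSum.ker := (Subgroup.map_mono range_incl_le_ker).trans (map_ker_expSum_le φ)
  have hcomm : F ≤ ⁅F, expSum.ker⁆ := by
    refine (Subgroup.map_mono range_incl_le_commutator).trans ?_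
    rw [Subgroup.map_commutator]
    exact Subgroup.commutator_mono le_rfl (map_ker_expSum_le φ)
  have hL : ((F.map toSL).comap L).map L = F.map toSL :=
    Subgroup.map_comap_eq_self ((Subgroup.map_mono hF).trans map_toSL_ker_expSum_le)
  have hN : (F.map toSL).comap L = ⊥ := by
    refine PingPong.eq_bot_of_le_commutator ?_
    rw [← Subgroup.map_le_map_iff_of_injective PingPong.injective_lift_hyperbolic,
      Subgroup.map_commutator, hL, ← MonoidHom.range_eq_map]
    refine (Subgroup.map_mono hcomm).trans ?_
    rw [Subgroup.map_commutator]
    exact Subgroup.commutator_mono le_rfl map_toSL_ker_expSum_le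
  rw [hN, Subgroup.map_bot] at hL
  intro g hg
  refine mem_range_incl (hF hg) ?_
  have : toSL g ∈ F.map toSL := Subgroup.mem_map_of_mem _ hg
  rwa [← hL, Subgroup.mem_bot] at this

theorem exists_incl_eq (φ : MulAut B4) (f : FreeGroup (Fin 2)) : ∃ f', incl f' = φ (incl f) :=
  map_range_incl_le φ (Subgroup.mem_map_of_mem _ ⟨f, rfl⟩)

/-- The restriction of an automorphism of the braid group to its normal free subgroup of rank
two. -/
noncomputable def restrictFun (φ : MulAut B4) (f : FreeGroup (Fin 2)) : FreeGroup (Fin 2) :=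
  (exists_incl_eq φ f).choose

theorem incl_restrictFun (φ : MulAut B4) (f : FreeGroup (Fin 2)) :
    incl (restrictFun φ f) = φ (incl f) := (exists_incl_eq φ f).choose_spec

/-- Restriction of automorphisms of the braid group to its normal free subgroup of rank two. -/
noncomputable def restrict : MulAut B4 →* MulAut (FreeGroup (Fin 2)) where
  toFun φ :=
    { toFun := restrictFun φ
      invFun := restrictFun φ⁻¹
      left_inv := fun f => incl_injective (by simp [incl_restrictFun])
      right_inv := fun f => incl_injective (by simp [incl_restrictFun])
      map_mul' := fun f f' => incl_injective (by simp [incl_restrictFun]) }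
  map_one' := MulEquiv.ext fun f => incl_injective (incl_restrictFun 1 f)
  map_mul' φ ψ := MulEquiv.ext fun f => incl_injective <| by
    change incl (restrictFun (φ * ψ) f) = incl (restrictFun φ (restrictFun ψ f))
    simp [incl_restrictFun]

theorem incl_restrict (φ : MulAut B4) (f : FreeGroup (Fin 2)) :
    incl (restrict φ f) = φ (incl f) := incl_restrictFun φ f

theorem action_apply_eq {φ : MulAut B4} (hφ : restrict φ = 1) (g : B4) :
    action (φ g) = action g := by
  have h (f : FreeGroup (Fin 2)) : φ (incl f) = incl f := by
    rw [← incl_restrict, hφ, MulAut.one_apply]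
  refine MulEquiv.ext fun f => incl_injective ?_
  rw [← conj_incl, ← h (action g f), ← conj_incl g, map_mul, map_mul, map_inv, h]

theorem restrict_injective : Function.Injective restrict := by
  refine (injective_iff_map_eq_one _).2 fun φ hφ => ?_
  have haction (g : B4) : action (g⁻¹ * φ g) = 1 := by
    rw [map_mul, map_inv, action_apply_eq hφ, inv_mul_cancel]
  have hexp (g : B4) : (expSum (φ g)).toAdd = (expSum g).toAdd * (expSum (φ a)).toAdd := by
    have := hom_eq_zpow_expSum (expSum.comp φ.toMonoidHom) g
    simpa using congrArg Multiplicative.toAdd this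
  have hunit : IsUnit (expSum (φ a)).toAdd := by
    refine .of_mul_eq_one_right (expSum (φ⁻¹ a)).toAdd ?_
    rw [← hexp]
    simp
  have hone : (expSum (φ a)).toAdd = 1 := by
    have := three_dvd_expSum (toSL_eq_one_of_action_eq_one (haction a))
    simp only [map_mul, map_inv, toAdd_mul, toAdd_inv, expSum_a, toAdd_ofAdd] at this
    rcases Int.isUnit_iff.1 hunit with h | h
    · exact h
    · rw [h] at this
      omega
  refine MulEquiv.ext fun g => ?_
  rw [MulAut.one_apply, eq_comm, ← inv_mul_eq_one]
  refine eq_one_of_action_eq_one ?_ (haction g)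
  rw [map_mul, map_inv, inv_mul_eq_one]
  apply Multiplicative.toAdd.injective
  rw [hexp, hone, mul_one]

/-- The endomorphism of the braid group inverting the standard generators. -/
def invHom : B4 →* B4 :=
  lift (s := a⁻¹) (t := b⁻¹) (u := c⁻¹)
    (by simpa [mul_assoc] using congrArg (·⁻¹) a_mul_b_mul_a)
    (by simpa [mul_assoc] using congrArg (·⁻¹) b_mul_c_mul_b)
    (by simpa using congrArg (·⁻¹) a_mul_c.symm)

@[simp] theorem invHom_a : invHom a = a⁻¹ := lift_a ..
@[simp] theorem invHom_b : invHom b = b⁻¹ := lift_b ..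
@[simp] theorem invHom_c : invHom c = c⁻¹ := lift_c ..

/-- The automorphism of the braid group inverting the standard generators. -/
def invAut : MulAut B4 :=
  have h : invHom.comp invHom = MonoidHom.id B4 := hom_ext (by simp) (by simp) (by simp)
  MonoidHom.toMulEquiv invHom invHom h h

theorem invAut_a : invAut a = a⁻¹ := invHom_a
theorem invAut_b : invAut b = b⁻¹ := invHom_b
theorem invAut_c : invAut c = c⁻¹ := invHom_c

theorem restrict_invAut_zero : restrict invAut (of 0) = (of 0)⁻¹ := by
  apply incl_injective
  rw [incl_restrict, incl_zero, map_mul, map_inv, map_inv, incl_zero, invAut_a, invAut_c,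
    a_mul_c_inv]
  group

theorem restrict_invAut_one : restrict invAut (of 1) = (of 0)⁻¹ * of 1 * of 0 := by
  have h : of 1 = of 0 * action b (of 0)⁻¹ := by simp
  have h' : action b⁻¹ (of 0) = of 1 * of 0 := by
    rw [map_inv, MulAut.inv_apply, MulEquiv.symm_apply_eq]
    simp
  have h0 : invAut (incl (of 0)) = incl (of 0)⁻¹ := by
    rw [← incl_restrict, restrict_invAut_zero]
  apply incl_injective
  rw [incl_restrict]
  conv_lhs => rw [h]
  rw [map_mul, ← conj_incl, map_inv incl, map_mul, map_mul, map_mul, map_inv, map_inv, h0,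
    invAut_b, map_inv incl, inv_inv, conj_incl, h', ← map_inv, ← map_mul, mul_assoc]

theorem restrict_conj (g : B4) : restrict (MulAut.conj g) = action g :=
  MulEquiv.ext fun f => incl_injective <| by
    rw [incl_restrict, MulAut.conj_apply, conj_incl]

theorem restrict_surjective : Function.Surjective restrict := by
  rw [← MonoidHom.range_eq_top]
  have haction (g : B4) : action g ∈ restrict.range := ⟨_, restrict_conj g⟩
  have hconj (q : FreeGroup (Fin 2)) : MulAut.conj q ∈ restrict.range := by
    rw [← action_incl]
    exact haction _
  have hI : MulAut.conj (of 0) * restrict invAut ∈ restrict.range :=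
    mul_mem (hconj _) ⟨_, rfl⟩
  have hJ : MulAut.conj (of 1) * action (a * b * a) ∈ restrict.range :=
    mul_mem (hconj _) (haction _)
  refine FreeGroup.nielsen_rank_two _ hconj hI (mul_mem hJ hI) (haction a) ?_ ?_ ?_ ?_ ?_ ?_ <;>
    simp [restrict_invAut_zero, restrict_invAut_one, mul_assoc]

end B4

/-- The automorphism group `Aut(F₂)` of the free group on 2 generators is
isomorphic to the automorphism group `Aut(B₄)` of the braid group on 4 strings. -/
theorem autF2_iso_autB4 :
    Nonempty (MulAut (FreeGroup (Fin 2)) ≃* MulAut B4) := by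
  exact ⟨(MulEquiv.ofBijective B4.restrict ⟨B4.restrict_injective, B4.restrict_surjective⟩).symm⟩
end

section
/- The inner automorphism group Inn(B₄), i.e. the range of the conjugation homomorphism B₄ → Aut(B₄), is a subgroup of index 2 in Aut(B₄). -/
namespace BraidFour

/-- The free group on two letters `x` and `y`. -/
abbrev F2 : Type := FreeGroup Bool

/-- The first free generator. -/
abbrev x : F2 := FreeGroup.of false

/-- The second free generator. -/
abbrev y : F2 := FreeGroup.of true

/-! ### A rotation of order four of the free group -/

/-- The quarter turn `x ↦ y ↦ x⁻¹ ↦ y⁻¹ ↦ x` on letters. -/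
def rotLetter (l : Bool × Bool) : Bool × Bool := (!l.1, xor l.1 l.2)

/-- The automorphism `x ↦ y ↦ x⁻¹` of the free group, as an endomorphism. -/
def rot : F2 →* F2 := FreeGroup.lift fun i => if i then x⁻¹ else y

@[simp] lemma rot_x : rot x = y := by simp [rot, x]
@[simp] lemma rot_y : rot y = x⁻¹ := by simp [rot, y]

lemma rot_mk (L : List (Bool × Bool)) :
    rot (FreeGroup.mk L) = FreeGroup.mk (L.map rotLetter) := by
  induction L with
  | nil => simp [← FreeGroup.one_eq_mk]
  | cons l L ih =>
    rw [show l :: L = [l] ++ L from rfl, ← FreeGroup.mul_mk, map_mul, ih, List.map_append,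
      ← FreeGroup.mul_mk]
    congr 1
    rcases l with ⟨_ | _, _ | _⟩ <;>
      simp [rot, rotLetter, FreeGroup.of, FreeGroup.inv_mk, FreeGroup.invRev]

lemma rot_rot_rot_rot (w : F2) : rot (rot (rot (rot w))) = w := by
  have h : (rot.comp (rot.comp (rot.comp rot))) = MonoidHom.id F2 := by
    ext i
    cases i <;> simp
  exact DFunLike.congr_fun h w

lemma isReduced_map_rotLetter {L : List (Bool × Bool)} (hL : FreeGroup.IsReduced L) :
    FreeGroup.IsReduced (L.map rotLetter) := by
  unfold FreeGroup.IsReduced at *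
  rw [List.isChain_map]
  refine hL.imp ?_
  decide

lemma norm_eq_length_of_mk {g : F2} {L : List (Bool × Bool)} (hL : FreeGroup.IsReduced L)
    (hg : g = FreeGroup.mk L) : g.norm = L.length := by
  rw [hg, FreeGroup.norm, FreeGroup.toWord_mk, hL.reduce_eq]

/-- The centre of the free group of rank two is trivial. -/
lemma eq_one_of_forall_commute {w : F2} (hw : ∀ v, v * w = w * v) : w = 1 := by
  by_contra hne
  have hL : w.toWord ≠ [] := by simpa using hne
  have hred : FreeGroup.IsReduced w.toWord := FreeGroup.isReduced_toWord
  obtain ⟨r, hr₁, hr₂⟩ : ∃ r : Bool × Bool,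
      ((r.1 = (w.toWord.head hL).1 → r.2 = (w.toWord.head hL).2)) ∧
      ((w.toWord.getLast hL).1 = r.1 → (w.toWord.getLast hL).2 = !r.2) := by
    generalize w.toWord.head hL = s
    generalize w.toWord.getLast hL = t
    revert s t
    decide
  have hchain : FreeGroup.IsReduced ([r] ++ w.toWord ++ [(r.1, !r.2)]) := by
    unfold FreeGroup.IsReduced at *
    refine List.IsChain.append (List.IsChain.append (by simp) hred ?_) (by simp) ?_
    · intro u hu v hv
      simp only [List.getLast?_singleton, Option.mem_some_iff] at hu
      rw [List.head?_eq_some_head hL, Option.mem_some_iff] at hv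
      subst hu hv
      exact hr₁
    · intro u hu v hv
      rw [List.getLast?_append_of_ne_nil _ hL, List.getLast?_eq_some_getLast hL,
        Option.mem_some_iff] at hu
      simp only [List.head?_cons, Option.mem_some_iff] at hv
      subst hu hv
      exact hr₂
  have key : w = FreeGroup.mk ([r] ++ w.toWord ++ [(r.1, !r.2)]) := by
    rw [← FreeGroup.mul_mk, ← FreeGroup.mul_mk, FreeGroup.mk_toWord, hw, mul_assoc]
    have : FreeGroup.mk [r] * FreeGroup.mk [(r.1, !r.2)] = 1 := by
      rw [show [(r.1, !r.2)] = FreeGroup.invRev [r] from rfl, ← FreeGroup.inv_mk, mul_inv_cancel]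
    rw [this, mul_one]
  have := norm_eq_length_of_mk hchain key
  simp only [FreeGroup.norm, List.length_append, List.length_singleton] at this
  omega

lemma isReduced_append_map_rotLetter {L : List (Bool × Bool)} (hne : L ≠ [])
    (hL : FreeGroup.IsReduced L)
    (h : rotLetter (L.head hne) ≠ ((L.getLast hne).1, !(L.getLast hne).2)) :
    FreeGroup.IsReduced (L ++ L.map rotLetter ++ (L.map rotLetter).map rotLetter ++
      ((L.map rotLetter).map rotLetter).map rotLetter) := by
  have h₁ := isReduced_map_rotLetter hL
  have h₂ := isReduced_map_rotLetter h₁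
  have h₃ := isReduced_map_rotLetter h₂
  unfold FreeGroup.IsReduced at *
  refine List.IsChain.append (List.IsChain.append (List.IsChain.append hL h₁ ?_) h₂ ?_) h₃ ?_ <;>
  · intro u hu v hv
    simp [List.getLast?_append, List.getLast?_eq_some_getLast hne,
      List.head?_eq_some_head hne] at hu hv
    subst hu hv
    generalize L.head hne = s at *
    generalize L.getLast hne = t at *
    revert s t
    decide

/-- Cocycles of the cyclic group of order four acting on the free group by `rot` are
coboundaries. -/
lemma exists_eq_inv_mul_rot (n : F2) (hn : n * rot n * rot (rot n) * rot (rot (rot n)) = 1) :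
    ∃ w, n = w⁻¹ * rot w := by
  induction hk : n.norm using Nat.strong_induction_on generalizing n with
  | _ k ih =>
  subst hk
  by_cases h1 : n = 1
  · exact ⟨1, by simp [h1]⟩
  have hne : n.toWord ≠ [] := by simpa using h1
  have hred : FreeGroup.IsReduced n.toWord := FreeGroup.isReduced_toWord
  by_cases h : rotLetter (n.toWord.head hne) = ((n.toWord.getLast hne).1, !(n.toWord.getLast hne).2)
  · obtain ⟨s, M, t, hM⟩ : ∃ s M t, n.toWord = [s] ++ M ++ [t] := by
      rcases hw : n.toWord with _ | ⟨s, L⟩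
      · exact absurd hw hne
      · rcases L.eq_nil_or_concat with rfl | ⟨M, t, rfl⟩
        · exfalso
          simp only [hw, List.head_singleton, List.getLast_singleton] at h
          clear hw
          revert s
          decide
        · exact ⟨s, M, t, by simp⟩
    have hst : t = ((rotLetter s).1, !(rotLetter s).2) := by
      simp only [hM] at h
      simp at h
      rw [h]
      simp
    have hnm : n = FreeGroup.mk [s] * FreeGroup.mk M * (rot (FreeGroup.mk [s]))⁻¹ := by
      rw [rot_mk, FreeGroup.inv_mk, FreeGroup.mul_mk, FreeGroup.mul_mk]
      rw [show FreeGroup.invRev ([s].map rotLetter) = [t] by simp [hst, FreeGroup.invRev]]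
      rw [← hM, FreeGroup.mk_toWord]
    obtain ⟨w, hw⟩ := ih (FreeGroup.mk M).norm
      (by
        have := FreeGroup.norm_mk_le (L₁ := M)
        have h' : n.norm = _ := congrArg List.length hM
        simp at h'
        omega) (FreeGroup.mk M)
      (by
        generalize FreeGroup.mk [s] = S at *
        generalize FreeGroup.mk M = m at *
        rw [hnm] at hn
        simp only [map_mul, map_inv, rot_rot_rot_rot] at hn
        have : S * (m * rot m * rot (rot m) * rot (rot (rot m))) * S⁻¹ = 1 := by
          rw [← hn]
          group
        simpa using this) rfl
    exact ⟨w * (FreeGroup.mk [s])⁻¹, by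
      rw [hnm, hw, mul_inv_rev, inv_inv, map_mul, map_inv]; simp only [mul_assoc]⟩
  · have hlen := norm_eq_length_of_mk (isReduced_append_map_rotLetter hne hred h) (g := 1) (by
      rw [← hn, ← FreeGroup.mul_mk, ← FreeGroup.mul_mk, ← FreeGroup.mul_mk]
      simp only [← rot_mk, FreeGroup.mk_toWord])
    simp only [FreeGroup.norm_one, List.length_append, List.length_map] at hlen
    exact absurd (List.length_eq_zero_iff.1 (by omega)) hne

/-- The number of quarter turns taking `x` to a given letter. -/
def quarterTurns : Bool × Bool → ℕ
  | (false, true) => 0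
  | (true, true) => 1
  | (false, false) => 2
  | (true, false) => 3

lemma map_iterate_rotLetter (k : ℕ) (L : List (Bool × Bool)) :
    (List.map rotLetter)^[k] L = L.map (rotLetter^[k]) := by
  induction k generalizing L with
  | zero => simp
  | succ k ih => simp [ih]

/-- A substitution `x ↦ g`, `y ↦ rot g` with `rot (rot g) = g⁻¹` is surjective only if
`g` is a single letter. -/
lemma norm_eq_one_of_surjective {g : F2} (hg : rot (rot g) = g⁻¹) {ψ : F2 →* F2}
    (hx : ψ x = g) (hy : ψ y = rot g) (hψ : Function.Surjective ψ) : g.norm = 1 := by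
  set L := g.toWord with hLdef
  have hL : L ≠ [] := by
    intro h
    have hg1 : g = 1 := by simpa [hLdef] using h
    have : ψ = 1 := by
      ext i
      cases i
      · exact hx.trans hg1
      · exact hy.trans (by simp [hg1])
    obtain ⟨v, hv⟩ := hψ x
    rw [this] at hv
    exact FreeGroup.one_ne_of _ hv
  have hred : FreeGroup.IsReduced L := FreeGroup.isReduced_toWord
  have hgL : g = FreeGroup.mk L := FreeGroup.mk_toWord.symm
  have hinv : (L.map rotLetter).map rotLetter = FreeGroup.invRev L := by
    have := congrArg FreeGroup.toWord hg
    rw [FreeGroup.toWord_inv, ← hLdef, hgL, rot_mk, rot_mk, FreeGroup.toWord_mk,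
      (isReduced_map_rotLetter (isReduced_map_rotLetter hred)).reduce_eq] at this
    exact this
  have hends : L.getLast hL = L.head hL := by
    have h := congrArg List.head? hinv
    simp [FreeGroup.invRev, List.getLast?_eq_some_getLast hL,
      List.head?_eq_some_head hL] at h
    revert h
    generalize L.head hL = s
    generalize L.getLast hL = t
    revert s t
    decide
  let W : Bool × Bool → List (Bool × Bool) := fun l => L.map (rotLetter^[quarterTurns l])
  have hWlen : ∀ l, (W l).length = L.length := fun l => by simp [W]
  have hWne : ∀ l, W l ≠ [] := fun l => by simpa [W] using hL
  have hψL : ∀ K, ψ (FreeGroup.mk K) = FreeGroup.mk (K.flatMap W) := by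
    intro K
    induction K with
    | nil => simp [← FreeGroup.one_eq_mk]
    | cons l K ih =>
      rw [show l :: K = [l] ++ K from rfl, ← FreeGroup.mul_mk, map_mul, ih, List.flatMap_append,
        ← FreeGroup.mul_mk]
      congr 1
      rw [List.flatMap_singleton]
      have h1 : ψ (FreeGroup.mk [(false, true)]) = g := hx
      have h2 : ψ (FreeGroup.mk [(true, true)]) = rot g := hy
      have h3 : ψ (FreeGroup.mk [(false, false)]) = rot (rot g) := by
        rw [hg, ← h1, ← map_inv, FreeGroup.inv_mk]; rfl
      have h4 : ψ (FreeGroup.mk [(true, false)]) = rot (rot (rot g)) := by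
        rw [hg, map_inv, ← h2, ← map_inv, FreeGroup.inv_mk]; rfl
      rcases l with ⟨_ | _, _ | _⟩
      · rw [h3, hgL, rot_mk, rot_mk]; simp [W, quarterTurns]
      · rw [h1, hgL]; simp [W, quarterTurns]
      · rw [h4, hgL, rot_mk, rot_mk, rot_mk]; simp [W, quarterTurns, Function.comp_assoc]
      · rw [h2, hgL, rot_mk]; simp [W, quarterTurns]
  have hWred : ∀ K, FreeGroup.IsReduced K → FreeGroup.IsReduced (K.flatMap W) := by
    intro K hK
    unfold FreeGroup.IsReduced at hK ⊢
    rw [List.flatMap_def, List.isChain_flatten (by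
      rw [List.mem_map]
      rintro ⟨l, -, h⟩
      exact hWne l h)]
    refine ⟨?_, ?_⟩
    · intro l hl
      obtain ⟨l, -, rfl⟩ := List.mem_map.1 hl
      simp only [W, ← map_iterate_rotLetter]
      generalize quarterTurns l = k
      exact Function.Iterate.rec (fun l => FreeGroup.IsReduced l) hred
        (fun _ => isReduced_map_rotLetter) k
    · rw [List.isChain_map]
      refine hK.imp ?_
      intro l l' hll u hu v hv
      simp [W, List.getLast?_eq_some_getLast hL, List.head?_eq_some_head hL, hends] at hu hv
      subst hu hv
      clear hends
      generalize L.head hL = s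
      revert l l' s
      decide
  obtain ⟨v, hv⟩ := hψ x
  have hnorm := norm_eq_length_of_mk (hWred v.toWord FreeGroup.isReduced_toWord) (g := x)
    (by rw [← hψL, FreeGroup.mk_toWord, hv])
  rw [FreeGroup.norm_of, List.length_flatMap] at hnorm
  simp only [hWlen, List.map_const', List.sum_replicate, smul_eq_mul] at hnorm
  exact (_root_.mul_eq_one.1 hnorm.symm).2

/-! ### Basic facts on the braid group -/

lemma braid_ab : a * b * a = b * a * b := by
  have h := PresentedGroup.one_of_mem (rels := braidRels4)
    (x := FreeGroup.of 0 * FreeGroup.of 1 * FreeGroup.of 0 *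
      (FreeGroup.of 1 * FreeGroup.of 0 * FreeGroup.of 1)⁻¹) (by simp [braidRels4])
  exact mul_inv_eq_one.1 h

lemma braid_bc : b * c * b = c * b * c := by
  have h := PresentedGroup.one_of_mem (rels := braidRels4)
    (x := FreeGroup.of 1 * FreeGroup.of 2 * FreeGroup.of 1 *
      (FreeGroup.of 2 * FreeGroup.of 1 * FreeGroup.of 2)⁻¹) (by simp [braidRels4])
  exact mul_inv_eq_one.1 h

lemma braid_ac : a * c = c * a := by
  have h := PresentedGroup.one_of_mem (rels := braidRels4)
    (x := FreeGroup.of 0 * FreeGroup.of 2 * (FreeGroup.of 2 * FreeGroup.of 0)⁻¹)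
    (by simp [braidRels4])
  exact mul_inv_eq_one.1 h

section Lift

variable {G : Type*} [Group G] {A B C : G}

/-- The homomorphism out of the braid group given by a triple satisfying the braid relations. -/
def lift (A B C : G) (hab : A * B * A = B * A * B) (hbc : B * C * B = C * B * C)
    (hac : A * C = C * A) : B4 →* G :=
  PresentedGroup.toGroup (f := ![A, B, C]) (by
    rintro r (rfl | rfl | rfl)
    · simpa [mul_inv_eq_one, -mul_inv_rev] using hab
    · simpa [mul_inv_eq_one, -mul_inv_rev] using hbc
    · simpa [mul_inv_eq_one, -mul_inv_rev] using hac)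

variable (hab : A * B * A = B * A * B) (hbc : B * C * B = C * B * C) (hac : A * C = C * A)

@[simp] lemma lift_a : lift A B C hab hbc hac a = A := PresentedGroup.toGroup.of _
@[simp] lemma lift_b : lift A B C hab hbc hac b = B := PresentedGroup.toGroup.of _
@[simp] lemma lift_c : lift A B C hab hbc hac c = C := PresentedGroup.toGroup.of _

end Lift

lemma mem_of_generators_mem (H : Subgroup B4) (ha : a ∈ H) (hb : b ∈ H) (hc : c ∈ H) (g : B4) :
    g ∈ H :=
  PresentedGroup.generated_by _ H (by
    intro j
    fin_cases j
    exacts [ha, hb, hc]) g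

lemma hom_ext {G : Type*} [Monoid G] {f f' : B4 →* G} (ha : f a = f' a) (hb : f b = f' b)
    (hc : f c = f' c) : f = f' := by
  ext g
  exact mem_of_generators_mem (f.eqLocus f') ha hb hc g

/-- The exponent sum. -/
def lenHom : B4 →* Multiplicative ℤ :=
  lift (.ofAdd 1) (.ofAdd 1) (.ofAdd 1) rfl rfl rfl

/-- The exponent sum, as an integer. -/
def len (g : B4) : ℤ := (lenHom g).toAdd

@[simp] lemma len_a : len a = 1 := by simp [len, lenHom]
@[simp] lemma len_b : len b = 1 := by simp [len, lenHom]
@[simp] lemma len_c : len c = 1 := by simp [len, lenHom]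
@[simp] lemma len_one : len 1 = 0 := by simp [len]
@[simp] lemma len_mul (g h : B4) : len (g * h) = len g + len h := by simp [len]
@[simp] lemma len_inv (g : B4) : len g⁻¹ = -len g := by simp [len]
@[simp] lemma len_zpow (g : B4) (k : ℤ) : len (g ^ k) = k * len g := by simp [len]

/-- The rotation `abc`. -/
def δ : B4 := a * b * c

lemma δ_a : δ * a * δ⁻¹ = b := by
  rw [mul_inv_eq_iff_eq_mul, δ]
  calc a * b * c * a = a * b * (c * a) := by group
    _ = (a * b * a) * c := by rw [← braid_ac]; group
    _ = b * (a * b * c) := by rw [braid_ab]; group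

lemma δ_b : δ * b * δ⁻¹ = c := by
  rw [mul_inv_eq_iff_eq_mul, δ]
  calc a * b * c * b = a * (b * c * b) := by group
    _ = (a * c) * b * c := by rw [braid_bc]; group
    _ = c * (a * b * c) := by rw [braid_ac]; group

/-! ### The normal free subgroup -/

/-- The free subgroup of the braid group, generated by `ac⁻¹` and its conjugate by `abc`. -/
def incl : F2 →* B4 :=
  FreeGroup.lift fun i => if i then a * b * a * c⁻¹ * b⁻¹ * a⁻¹ else a * c⁻¹

@[simp] lemma incl_x : incl x = a * c⁻¹ := by simp [incl, x]
@[simp] lemma incl_y : incl y = a * b * a * c⁻¹ * b⁻¹ * a⁻¹ := by simp [incl, y]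

lemma inv_c_mul_a : c⁻¹ * a = a * c⁻¹ := by
  rw [inv_mul_eq_iff_eq_mul, ← mul_assoc, ← braid_ac, mul_inv_cancel_right]

lemma inv_a_mul_c : a⁻¹ * c = c * a⁻¹ := by
  rw [inv_mul_eq_iff_eq_mul, ← mul_assoc, braid_ac, mul_inv_cancel_right]

lemma a_conj_incl_x : a * incl x * a⁻¹ = incl x := by
  rw [incl_x, mul_inv_eq_iff_eq_mul, mul_assoc a c⁻¹ a, inv_c_mul_a]

lemma c_conj_incl_x : c * incl x * c⁻¹ = incl x := by
  rw [incl_x, ← mul_assoc c a, ← braid_ac, mul_inv_cancel_right]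

lemma conj_inv_c_b : c⁻¹ * b⁻¹ * c = b * c⁻¹ * b⁻¹ := by
  calc c⁻¹ * b⁻¹ * c = c⁻¹ * b⁻¹ * (c * b * c) * c⁻¹ * b⁻¹ := by group
    _ = b * c⁻¹ * b⁻¹ := by rw [← braid_bc]; group

lemma b_conj_incl_x : b * incl x * b⁻¹ = incl y * incl x := by
  symm
  rw [incl_x, incl_y]
  calc a * b * a * c⁻¹ * b⁻¹ * a⁻¹ * (a * c⁻¹) = a * b * a * (c * b * c)⁻¹ := by group
    _ = b * (a * c⁻¹) * b⁻¹ := by rw [← braid_bc, braid_ab]; group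

lemma b_conj_incl_y : b * incl y * b⁻¹ = incl y := by
  rw [incl_y]
  calc b * (a * b * a * c⁻¹ * b⁻¹ * a⁻¹) * b⁻¹
      = (b * a * b) * (a * c⁻¹) * (b * a * b)⁻¹ := by group
    _ = a * b * a * c⁻¹ * b⁻¹ * a⁻¹ := by rw [← inv_c_mul_a, ← braid_ab]; group

lemma a_mul_incl_y : a * incl y = incl y * c := by
  rw [incl_y]
  calc a * (a * b * a * c⁻¹ * b⁻¹ * a⁻¹)
      = a * ((a * b * a) * c⁻¹ * b⁻¹) * a⁻¹ := by group
    _ = a * b * (a * (b * c⁻¹ * b⁻¹)) * a⁻¹ := by rw [braid_ab]; group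
    _ = a * b * (a * c⁻¹ * b⁻¹ * (c * a⁻¹)) := by rw [← conj_inv_c_b]; group
    _ = a * b * a * c⁻¹ * b⁻¹ * a⁻¹ * c := by rw [← inv_a_mul_c]; group

lemma a_conj_incl_y : a * incl y * a⁻¹ = incl y * (incl x)⁻¹ := by
  rw [a_mul_incl_y, incl_x]
  group

lemma c_conj_incl_y : c * incl y * c⁻¹ = (incl x)⁻¹ * incl y := by
  rw [mul_inv_eq_iff_eq_mul, mul_assoc (incl x)⁻¹, ← a_mul_incl_y, incl_x]
  group

/-- The action of the braid generator `a` on the free subgroup. -/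
def actA : MulAut F2 :=
  MonoidHom.toMulEquiv (FreeGroup.lift fun i => if i then y * x⁻¹ else x)
    (FreeGroup.lift fun i => if i then y * x else x)
    (by ext i; cases i <;> simp [x, y]) (by ext i; cases i <;> simp [x, y])

/-- The action of the braid generator `b` on the free subgroup. -/
def actB : MulAut F2 :=
  MonoidHom.toMulEquiv (FreeGroup.lift fun i => if i then y else y * x)
    (FreeGroup.lift fun i => if i then y else y⁻¹ * x)
    (by ext i; cases i <;> simp [x, y]) (by ext i; cases i <;> simp [x, y])

/-- The action of the braid generator `c` on the free subgroup. -/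
def actC : MulAut F2 :=
  MonoidHom.toMulEquiv (FreeGroup.lift fun i => if i then x⁻¹ * y else x)
    (FreeGroup.lift fun i => if i then x * y else x)
    (by ext i; cases i <;> simp [x, y]) (by ext i; cases i <;> simp [x, y])

@[simp] lemma actA_x : actA x = x := by simp [actA, x]
@[simp] lemma actA_y : actA y = y * x⁻¹ := by simp [actA, y]
@[simp] lemma actB_x : actB x = y * x := by simp [actB, x]
@[simp] lemma actB_y : actB y = y := by simp [actB, y]
@[simp] lemma actC_x : actC x = x := by simp [actC, x]
@[simp] lemma actC_y : actC y = x⁻¹ * y := by simp [actC, y]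

lemma hom_ext_F2 {G : Type*} [Monoid G] {f f' : F2 →* G} (hx : f x = f' x) (hy : f y = f' y) :
    f = f' := by
  ext i
  cases i
  exacts [hx, hy]

lemma mulAut_ext_F2 {f f' : MulAut F2} (hx : f x = f' x) (hy : f y = f' y) : f = f' := by
  have := hom_ext_F2 (f := f.toMonoidHom) (f' := f'.toMonoidHom) hx hy
  ext w
  exact DFunLike.congr_fun this w

/-- The conjugation action of the braid group on the free subgroup. -/
def act : B4 →* MulAut F2 :=
  lift actA actB actC (mulAut_ext_F2 (by simp [mul_assoc]) (by simp [mul_assoc]))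
    (mulAut_ext_F2 (by simp [mul_assoc]) (by simp [mul_assoc]))
    (mulAut_ext_F2 (by simp) (by simp [mul_assoc]))

@[simp] lemma act_a : act a = actA := by simp [act]
@[simp] lemma act_b : act b = actB := by simp [act]
@[simp] lemma act_c : act c = actC := by simp [act]

lemma conj_incl (g : B4) (w : F2) : g * incl w * g⁻¹ = incl (act g w) := by
  let H : Subgroup B4 :=
    { carrier := {g | ∀ w, g * incl w * g⁻¹ = incl (act g w)}
      one_mem' := by simp
      mul_mem' := by
        intro g h hg hh w
        rw [map_mul, MulAut.mul_apply, ← hg, ← hh]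
        group
      inv_mem' := by
        intro g hg w
        obtain ⟨w, rfl⟩ := (act g).surjective w
        rw [← hg, map_inv, MulAut.inv_apply_self]
        group }
  have key {g : B4} (hx : g * incl x * g⁻¹ = incl (act g x))
      (hy : g * incl y * g⁻¹ = incl (act g y)) : g ∈ H := by
    intro w
    have := hom_ext_F2 (f := (MulAut.conj g).toMonoidHom.comp incl)
      (f' := incl.comp (act g).toMonoidHom) hx hy
    exact DFunLike.congr_fun this w
  refine mem_of_generators_mem H (key ?_ ?_) (key ?_ ?_) (key ?_ ?_) g w
  · rw [a_conj_incl_x, act_a, actA_x]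
  · rw [a_conj_incl_y, act_a, actA_y, map_mul, map_inv]
  · rw [b_conj_incl_x, act_b, actB_x, map_mul]
  · rw [b_conj_incl_y, act_b, actB_y]
  · rw [c_conj_incl_x, act_c, actC_x]
  · rw [c_conj_incl_y, act_c, actC_y, map_mul, map_inv]

lemma act_incl (w : F2) : act (incl w) = MulAut.conj w := by
  refine DFunLike.congr_fun (hom_ext_F2 (f := act.comp incl) (f' := MulAut.conj) ?_ ?_) w
  · refine mulAut_ext_F2 ?_ ?_
    · have : actC.symm x = x := by rw [MulEquiv.symm_apply_eq, actC_x]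
      simp [this]
    · have : actC.symm y = x * y := by rw [MulEquiv.symm_apply_eq]; simp
      simp [this, mul_assoc]
  · have h₁ : actA.symm x = x := by rw [MulEquiv.symm_apply_eq]; simp
    have h₂ : actA.symm y = y * x := by rw [MulEquiv.symm_apply_eq]; simp
    have h₃ : actB.symm x = y⁻¹ * x := by rw [MulEquiv.symm_apply_eq]; simp
    have h₄ : actB.symm y = y := by rw [MulEquiv.symm_apply_eq]; simp
    have h₅ : actC.symm x = x := by rw [MulEquiv.symm_apply_eq]; simp
    have h₆ : actC.symm y = x * y := by rw [MulEquiv.symm_apply_eq]; simp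
    refine mulAut_ext_F2 ?_ ?_
    · simp [h₁, h₃, h₅, h₆, mul_assoc]
    · simp [h₂, h₃, h₄, h₅, mul_assoc]

lemma incl_injective : Function.Injective incl := by
  rw [injective_iff_map_eq_one]
  intro w hw
  refine eq_one_of_forall_commute fun v => ?_
  have h := act_incl w
  rw [hw, map_one] at h
  have := DFunLike.congr_fun h v
  simp only [MulAut.one_apply, MulAut.conj_apply] at this
  rwa [eq_mul_inv_iff_mul_eq] at this

lemma act_δ (w : F2) : act δ w = rot w := by
  refine DFunLike.congr_fun (hom_ext_F2 (f := (act δ).toMonoidHom) (f' := rot) ?_ ?_) w <;>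
  simp [δ, mul_assoc]

/-! ### Linear representations -/

/-- Abelianization of the free group. -/
def abHom : F2 →* Multiplicative (Fin 2 → ℤ) :=
  FreeGroup.lift fun i => .ofAdd (if i then ![0, 1] else ![1, 0])

/-- Abelianization of the free group, in additive form. -/
def ab (w : F2) : Fin 2 → ℤ := (abHom w).toAdd

@[simp] lemma ab_x : ab x = ![1, 0] := by simp [ab, abHom, x]
@[simp] lemma ab_y : ab y = ![0, 1] := by simp [ab, abHom, y]
@[simp] lemma ab_one : ab 1 = 0 := by simp [ab]
@[simp] lemma ab_mul (v w : F2) : ab (v * w) = ab v + ab w := by simp [ab]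
@[simp] lemma ab_inv (w : F2) : ab w⁻¹ = -ab w := by simp [ab]

lemma ab_map (f : F2 →* F2) (M : Matrix (Fin 2) (Fin 2) ℤ) (hx : ab (f x) = M.mulVec ![1, 0])
    (hy : ab (f y) = M.mulVec ![0, 1]) (w : F2) : ab (f w) = M.mulVec (ab w) := by
  let L : Multiplicative (Fin 2 → ℤ) →* Multiplicative (Fin 2 → ℤ) :=
    AddMonoidHom.toMultiplicative M.mulVecLin.toAddMonoidHom
  refine DFunLike.congr_fun (hom_ext_F2 (f := abHom.comp f) (f' := L.comp abHom) ?_ ?_) w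
  · rw [← ab_x] at hx; exact hx
  · rw [← ab_y] at hy; exact hy

/-- The matrix of the action of `a` and `c` on the abelianization of the free subgroup. -/
def matA : Matrix.SpecialLinearGroup (Fin 2) ℤ := ⟨!![1, -1; 0, 1], by simp [Matrix.det_fin_two]⟩

/-- The matrix of the action of `b` on the abelianization of the free subgroup. -/
def matB : Matrix.SpecialLinearGroup (Fin 2) ℤ := ⟨!![1, 0; 1, 1], by simp [Matrix.det_fin_two]⟩

lemma coe_matA : (matA : Matrix (Fin 2) (Fin 2) ℤ) = !![1, -1; 0, 1] := rfl
lemma coe_matB : (matB : Matrix (Fin 2) (Fin 2) ℤ) = !![1, 0; 1, 1] := rfl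

lemma braid_matA_matB : matA * matB * matA = matB * matA * matB :=
  Subtype.ext (by simp [coe_matA, coe_matB])

/-- The linear action of the braid group on the abelianization of its free subgroup. -/
def rep : B4 →* Matrix.SpecialLinearGroup (Fin 2) ℤ :=
  lift matA matB matA braid_matA_matB braid_matA_matB.symm rfl

@[simp] lemma rep_a : rep a = matA := lift_a ..
@[simp] lemma rep_b : rep b = matB := lift_b ..
@[simp] lemma rep_c : rep c = matA := lift_c ..

lemma ab_act (g : B4) (w : F2) :
    ab (act g w) = (rep g : Matrix (Fin 2) (Fin 2) ℤ).mulVec (ab w) := by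
  let H : Subgroup B4 :=
    { carrier := {g | ∀ w, ab (act g w) = (rep g : Matrix (Fin 2) (Fin 2) ℤ).mulVec (ab w)}
      one_mem' := fun w => by
        simp only [map_one, MulAut.one_apply, Matrix.SpecialLinearGroup.coe_one, Matrix.one_mulVec]
      mul_mem' := by
        intro g h hg hh w
        rw [map_mul, MulAut.mul_apply, hg, hh, map_mul, Matrix.SpecialLinearGroup.coe_mul,
          Matrix.mulVec_mulVec]
      inv_mem' := by
        intro g hg w
        obtain ⟨w, rfl⟩ := (act g).surjective w
        rw [hg, map_inv, MulAut.inv_apply_self, Matrix.mulVec_mulVec,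
          ← Matrix.SpecialLinearGroup.coe_mul, ← map_mul, inv_mul_cancel]
        simp }
  refine mem_of_generators_mem H ?_ ?_ ?_ g w
  · refine ab_map (act a).toMonoidHom _ ?_ ?_ <;>
      ext i <;> fin_cases i <;> simp [coe_matA]
  · refine ab_map (act b).toMonoidHom _ ?_ ?_ <;>
      ext i <;> fin_cases i <;> simp [coe_matB]
  · refine ab_map (act c).toMonoidHom _ ?_ ?_ <;>
      ext i <;> fin_cases i <;> simp [coe_matA]

lemma rep_incl (w : F2) : rep (incl w) = 1 := by
  refine DFunLike.congr_fun (hom_ext_F2 (f := rep.comp incl) (f' := 1) ?_ ?_) w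
  · simp
  · simp [mul_assoc]

lemma len_incl (w : F2) : len (incl w) = 0 := by
  have : lenHom.comp incl = 1 := by
    refine hom_ext_F2 ?_ ?_ <;> simp [lenHom]
  exact DFunLike.congr_fun this w

/-! ### The kernel of the linear representation -/

section NormalForm

variable {Q : Type*} [Group Q] {A B : Q}

lemma eq_one_or_exists_mul {M : Type*} [Monoid M] {s : Set M} {m : M}
    (hm : m ∈ Submonoid.closure s) :
    m = 1 ∨ ∃ l ∈ s, ∃ m' ∈ Submonoid.closure s, m = l * m' := by
  induction hm using Submonoid.closure_induction_left with
  | one => exact Or.inl rfl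
  | mul_left l hl m' hm' _ => exact Or.inr ⟨l, hl, m', hm', rfl⟩

/-- In a quotient of the braid group on three strings, left multiplication by a generator or its
inverse preserves the double cosets of the Garside element meeting a positive monoid. -/
lemma exists_letter_mul_eq (hab : A * B * A = B * A * B) {m : Q}
    (hm : m ∈ Submonoid.closure {A⁻¹, B}) {l : Q} (hl : l ∈ ({A, B, A⁻¹, B⁻¹} : Set Q)) :
    ∃ k j : ℤ, ∃ m' ∈ Submonoid.closure {A⁻¹, B},
      l * m = (A * B * A) ^ k * m' * (A * B * A) ^ j := by
  have hA : A⁻¹ ∈ Submonoid.closure {A⁻¹, B} := Submonoid.subset_closure (by simp)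
  have hB : B ∈ Submonoid.closure {A⁻¹, B} := Submonoid.subset_closure (by simp)
  rcases hl with rfl | rfl | rfl | rfl
  · rcases eq_one_or_exists_mul hm with rfl | ⟨l', rfl | rfl, m', hm', rfl⟩
    · refine ⟨1, -1, B, hB, ?_⟩
      calc l * 1 = (l * B * l) * B * (B * l * B)⁻¹ := by group
        _ = _ := by rw [← hab, zpow_one, zpow_neg_one]
    · exact ⟨0, 0, m', hm', by group⟩
    · exact ⟨1, 0, l⁻¹ * m', mul_mem hA hm', by group⟩
  · exact ⟨0, 0, l * m, mul_mem hB hm, by group⟩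
  · exact ⟨0, 0, A⁻¹ * m, mul_mem hA hm, by group⟩
  · rcases eq_one_or_exists_mul hm with rfl | ⟨l', rfl | rfl, m', hm', rfl⟩
    · refine ⟨1, -1, A⁻¹, hA, ?_⟩
      calc B⁻¹ * 1 = (A * B) * (B * A * B)⁻¹ := by group
        _ = _ := by rw [← hab]; group
    · refine ⟨-1, 0, B * m', mul_mem hB hm', ?_⟩
      calc B⁻¹ * (A⁻¹ * m') = (B * A * B)⁻¹ * (B * m') := by group
        _ = _ := by rw [← hab]; group
    · exact ⟨0, 0, m', hm', by group⟩

lemma conj_zpow_mem_letters (hab : A * B * A = B * A * B) (k : ℤ) {l : Q}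
    (hl : l ∈ ({A, B, A⁻¹, B⁻¹} : Set Q)) :
    ((A * B * A) ^ k)⁻¹ * l * (A * B * A) ^ k ∈ ({A, B, A⁻¹, B⁻¹} : Set Q) := by
  have hA : A * B * A * A = B * (A * B * A) := by
    calc A * B * A * A = B * A * B * A := by rw [hab]
      _ = _ := by group
  have hB : A * B * A * B = A * (A * B * A) := by
    calc A * B * A * B = A * (B * A * B) := by group
      _ = _ := by rw [hab]
  generalize A * B * A = D at *
  have step₁ : ∀ l ∈ ({A, B, A⁻¹, B⁻¹} : Set Q), D⁻¹ * l * D ∈ ({A, B, A⁻¹, B⁻¹} : Set Q) := by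
    have h₁ : D⁻¹ * A * D = B := by rw [mul_assoc, ← hB, inv_mul_cancel_left]
    have h₂ : D⁻¹ * B * D = A := by rw [mul_assoc, ← hA, inv_mul_cancel_left]
    have hinv (l : Q) : D⁻¹ * l⁻¹ * D = (D⁻¹ * l * D)⁻¹ := by group
    intro l hl
    rcases hl with h | h | h | h <;> rw [h] <;> simp only [hinv, h₁, h₂] <;> simp
  have step₂ : ∀ l ∈ ({A, B, A⁻¹, B⁻¹} : Set Q), D * l * D⁻¹ ∈ ({A, B, A⁻¹, B⁻¹} : Set Q) := by
    have h₁ : D * A * D⁻¹ = B := by rw [hA, mul_inv_cancel_right]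
    have h₂ : D * B * D⁻¹ = A := by rw [hB, mul_inv_cancel_right]
    have hinv (l : Q) : D * l⁻¹ * D⁻¹ = (D * l * D⁻¹)⁻¹ := by group
    intro l hl
    rcases hl with h | h | h | h <;> rw [h] <;> simp only [hinv, h₁, h₂] <;> simp
  induction k with
  | zero => simpa using hl
  | succ i ih =>
    have := step₁ _ ih
    rw [zpow_add_one]
    convert this using 1
    group
  | pred i ih =>
    have := step₂ _ ih
    rw [zpow_sub_one]
    convert this using 1
    group

lemma exists_normal_form (hab : A * B * A = B * A * B) (hgen : Subgroup.closure {A, B} = ⊤)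
    (g : Q) : ∃ k j : ℤ, ∃ m ∈ Submonoid.closure {A⁻¹, B},
      g = (A * B * A) ^ k * m * (A * B * A) ^ j := by
  have step : ∀ l ∈ ({A, B, A⁻¹, B⁻¹} : Set Q), ∀ g : Q,
      (∃ k j : ℤ, ∃ m ∈ Submonoid.closure {A⁻¹, B}, g = (A * B * A) ^ k * m * (A * B * A) ^ j) →
      ∃ k j : ℤ, ∃ m ∈ Submonoid.closure {A⁻¹, B},
        l * g = (A * B * A) ^ k * m * (A * B * A) ^ j := by
    rintro l hl g ⟨k, j, m, hm, rfl⟩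
    obtain ⟨k', j', m', hm', h⟩ := exists_letter_mul_eq hab hm (conj_zpow_mem_letters hab k hl)
    refine ⟨k + k', j' + j, m', hm', ?_⟩
    generalize A * B * A = D at *
    calc l * (D ^ k * m * D ^ j) = D ^ k * ((D ^ k)⁻¹ * l * D ^ k * m) * D ^ j := by group
      _ = _ := by rw [h]; group
  have hg : g ∈ Subgroup.closure {A, B} := hgen ▸ Subgroup.mem_top g
  induction hg using Subgroup.closure_induction_left with
  | one => exact ⟨0, 0, 1, one_mem _, by simp⟩
  | mul_left l hl g _ ih =>
    refine step l ?_ g ih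
    rcases hl with rfl | rfl <;> simp
  | inv_mul_cancel l hl g _ ih =>
    refine step l⁻¹ ?_ g ih
    rcases hl with rfl | rfl <;> simp

lemma entries_nonneg {P : Q →* Matrix.SpecialLinearGroup (Fin 2) ℤ} (hA : P A = matA)
    (hB : P B = matB) {m : Q} (hm : m ∈ Submonoid.closure {A⁻¹, B}) :
    0 ≤ P m 0 0 ∧ 0 ≤ P m 0 1 ∧ 0 ≤ P m 1 0 ∧ 0 ≤ P m 1 1 ∧
      (m = 1 ∨ 3 ≤ P m 0 0 + P m 0 1 + P m 1 0 + P m 1 1) := by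
  induction hm using Submonoid.closure_induction_left with
  | one => simp
  | mul_left l hl m hm ih =>
    have hdet := (P m).det_coe
    rw [Matrix.det_fin_two] at hdet
    have hl' : (P l : Matrix (Fin 2) (Fin 2) ℤ) = !![1, 1; 0, 1] ∨
        (P l : Matrix (Fin 2) (Fin 2) ℤ) = !![1, 0; 1, 1] := by
      rcases hl with rfl | rfl
      · left
        rw [map_inv, hA, Matrix.SpecialLinearGroup.coe_inv, coe_matA]
        simp [Matrix.adjugate_fin_two]
      · right
        rw [hB, coe_matB]
    have hmul : (P (l * m) : Matrix (Fin 2) (Fin 2) ℤ) =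
        (P l : Matrix (Fin 2) (Fin 2) ℤ) * P m := by
      rw [map_mul, Matrix.SpecialLinearGroup.coe_mul]
    obtain ⟨h₀₀, h₀₁, h₁₀, h₁₁, -⟩ := ih
    rw [hmul]
    generalize (P m : Matrix (Fin 2) (Fin 2) ℤ) = X at *
    have hr₀ : 1 ≤ X 0 0 + X 0 1 := by
      by_contra! h
      have e₁ : X 0 0 = 0 := by omega
      have e₂ : X 0 1 = 0 := by omega
      simp [e₁, e₂] at hdet
    have hr₁ : 1 ≤ X 1 0 + X 1 1 := by
      by_contra! h
      have e₁ : X 1 0 = 0 := by omega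
      have e₂ : X 1 1 = 0 := by omega
      simp [e₁, e₂] at hdet
    rcases hl' with h | h <;> rw [h] <;> simp [Matrix.mul_apply, Fin.sum_univ_two] <;> omega

lemma garside_matrix_pow_mod_four (i : ℤ) {X : Matrix.SpecialLinearGroup (Fin 2) ℤ}
    (h : X = (matA * matB * matA) ^ i) (h₀₀ : 0 ≤ X 0 0) (h₀₁ : 0 ≤ X 0 1) (h₁₀ : 0 ≤ X 1 0) :
    4 ∣ i ∧ X = 1 := by
  have hS : ((matA * matB * matA : Matrix.SpecialLinearGroup (Fin 2) ℤ) :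
      Matrix (Fin 2) (Fin 2) ℤ) = !![0, -1; 1, 0] := by simp [coe_matA, coe_matB]
  generalize matA * matB * matA = S at *
  have h₂ : ((S ^ 2 : Matrix.SpecialLinearGroup (Fin 2) ℤ) : Matrix (Fin 2) (Fin 2) ℤ) =
      !![-1, 0; 0, -1] := by
    rw [Matrix.SpecialLinearGroup.coe_pow, hS]; simp [pow_two]
  have h₃ : ((S ^ 3 : Matrix.SpecialLinearGroup (Fin 2) ℤ) : Matrix (Fin 2) (Fin 2) ℤ) =
      !![0, 1; -1, 0] := by
    rw [pow_succ, Matrix.SpecialLinearGroup.coe_mul, h₂, hS]; simp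
  have h₄ : S ^ 4 = 1 := Subtype.ext (by
    rw [pow_succ, Matrix.SpecialLinearGroup.coe_mul, h₃, hS]; simp [Matrix.one_fin_two])
  have hmod : X = S ^ (i % 4) := by
    rw [h]
    conv_lhs => rw [← Int.mul_ediv_add_emod i 4, zpow_add, zpow_mul]
    rw [show S ^ (4 : ℤ) = S ^ 4 from rfl, h₄]
    simp
  have hlt := Int.emod_lt_of_pos i (by norm_num : (0 : ℤ) < 4)
  have hnn := Int.emod_nonneg i (by norm_num : (4 : ℤ) ≠ 0)
  rw [Int.dvd_iff_emod_eq_zero]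
  generalize i % 4 = r at *
  interval_cases r
  · simpa using hmod
  · rw [zpow_one] at hmod
    rw [hmod, hS] at h₀₁
    simp at h₀₁
  · rw [show S ^ (2 : ℤ) = S ^ 2 from rfl] at hmod
    rw [hmod, h₂] at h₀₀
    simp at h₀₀
  · rw [show S ^ (3 : ℤ) = S ^ 3 from rfl] at hmod
    rw [hmod, h₃] at h₁₀
    simp at h₁₀

lemma exists_eq_zpow_of_map_eq_one (hab : A * B * A = B * A * B)
    (hgen : Subgroup.closure {A, B} = ⊤) {P : Q →* Matrix.SpecialLinearGroup (Fin 2) ℤ}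
    (hA : P A = matA) (hB : P B = matB) {g : Q} (hg : P g = 1) :
    ∃ i : ℤ, g = (A * B * A) ^ (4 * i) := by
  obtain ⟨k, j, m, hm, rfl⟩ := exists_normal_form hab hgen g
  obtain ⟨h₀₀, h₀₁, h₁₀, h₁₁, hsum⟩ := entries_nonneg hA hB hm
  have hPm : P m = (matA * matB * matA) ^ (-k + -j) := by
    simp only [map_mul, map_zpow, hA, hB] at hg
    generalize matA * matB * matA = S at *
    rw [zpow_add, zpow_neg, zpow_neg, eq_mul_inv_iff_mul_eq, eq_inv_iff_mul_eq_one]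
    have : S ^ k * (P m * S ^ j * S ^ k) * (S ^ k)⁻¹ = 1 := by
      rw [← hg]; group
    simpa using this
  obtain ⟨⟨i, hi⟩, h1⟩ := garside_matrix_pow_mod_four _ hPm h₀₀ h₀₁ h₁₀
  rw [h1] at hsum
  obtain rfl : m = 1 := by
    rcases hsum with h | h
    · exact h
    · simp at h
  refine ⟨-i, ?_⟩
  rw [mul_one, ← zpow_add]
  congr 1
  omega

end NormalForm

lemma incl_range_normal : incl.range.Normal where
  conj_mem := by
    rintro _ ⟨w, rfl⟩ g
    exact ⟨act g w, (conj_incl g w).symm⟩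

lemma exists_eq_incl_mul_zpow {g : B4} (hg : rep g = 1) :
    ∃ (w : F2) (i : ℤ), g = incl w * (a * b * a) ^ (4 * i) := by
  have := incl_range_normal
  let π : B4 →* B4 ⧸ incl.range := QuotientGroup.mk' incl.range
  let P : (B4 ⧸ incl.range) →* Matrix.SpecialLinearGroup (Fin 2) ℤ :=
    QuotientGroup.lift incl.range rep (by
      rintro _ ⟨w, rfl⟩
      exact rep_incl w)
  have hac : π c = π a := by
    refine (QuotientGroup.eq.2 ⟨x, ?_⟩)
    rw [incl_x, inv_c_mul_a]
  have hgen : Subgroup.closure {π a, π b} = ⊤ := by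
    rw [eq_top_iff]
    rintro q -
    obtain ⟨g, rfl⟩ := QuotientGroup.mk'_surjective incl.range q
    refine mem_of_generators_mem ((Subgroup.closure {π a, π b}).comap π) ?_ ?_ ?_ g
    · exact Subgroup.subset_closure (by simp)
    · exact Subgroup.subset_closure (by simp)
    · exact Subgroup.subset_closure (by simp [hac])
  obtain ⟨i, hi⟩ := exists_eq_zpow_of_map_eq_one (Q := B4 ⧸ incl.range) (A := π a) (B := π b)
    (by simp only [← map_mul, braid_ab]) hgen (P := P) rep_a rep_b (g := π g) hg
  rw [← map_mul, ← map_mul, ← map_zpow] at hi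
  obtain ⟨w, hw⟩ := QuotientGroup.eq.1 hi.symm
  have hconj := conj_incl ((a * b * a) ^ (4 * i)) w
  refine ⟨act ((a * b * a) ^ (4 * i)) w, i, ?_⟩
  rw [← hconj, hw]
  group

lemma exists_eq_incl_of_len {g : B4} (hg : rep g = 1) (h : len g = 0 ∨ len g = -2 ∨ len g = -6) :
    ∃ w, g = incl w := by
  obtain ⟨w, i, rfl⟩ := exists_eq_incl_mul_zpow hg
  have hlen : len (incl w * (a * b * a) ^ (4 * i)) = 12 * i := by
    simp [len_incl]
    ring
  obtain rfl : i = 0 := by omega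
  exact ⟨w, by simp⟩

/-! ### The free subgroup is characteristic -/

lemma mulVec_ext {X Y : Matrix (Fin 2) (Fin 2) ℤ} (hx : X.mulVec (ab x) = Y.mulVec (ab x))
    (hy : X.mulVec (ab y) = Y.mulVec (ab y)) : X = Y := by
  ext i j
  have h₀ := congrFun hx i
  have h₁ := congrFun hy i
  simp [Matrix.mulVec, dotProduct, Fin.sum_univ_two] at h₀ h₁
  fin_cases j
  exacts [h₀, h₁]

/-- An element of the braid group is determined by its action on the free subgroup and its
exponent sum. -/
lemma eq_of_act_eq {g h : B4} (hact : act g = act h) (hlen : len g = len h) : g = h := by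
  have hrep : rep (g * h⁻¹) = 1 := by
    have key (w : F2) : (rep (g * h⁻¹) : Matrix (Fin 2) (Fin 2) ℤ).mulVec (ab w) =
        (1 : Matrix (Fin 2) (Fin 2) ℤ).mulVec (ab w) := by
      rw [← ab_act, Matrix.one_mulVec, map_mul, hact, ← map_mul, mul_inv_cancel, map_one,
        MulAut.one_apply]
    exact Subtype.ext (mulVec_ext (key x) (key y))
  obtain ⟨w, hw⟩ := exists_eq_incl_of_len hrep (Or.inl (by simp [hlen]))
  have hconj : MulAut.conj w = 1 := by
    rw [← act_incl, ← hw, map_mul, hact, ← map_mul, mul_inv_cancel, map_one]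
  have : w = 1 := eq_one_of_forall_commute fun v => by
    have := DFunLike.congr_fun hconj v
    rw [MulAut.conj_apply, MulAut.one_apply, mul_inv_eq_iff_eq_mul] at this
    exact this.symm
  rwa [this, map_one, mul_inv_eq_one] at hw

lemma act_δ_pow_four : act (δ ^ 4) = 1 := by
  ext w
  simp only [pow_succ, pow_zero, one_mul, map_mul, MulAut.mul_apply, act_δ, rot_rot_rot_rot,
    MulAut.one_apply]

lemma commute_δ_pow_four (g : B4) : Commute (δ ^ 4) g :=
  eq_of_act_eq (by simp only [map_mul, act_δ_pow_four, one_mul, mul_one])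
    (by simp only [len_mul, add_comm])

lemma len_δ : len δ = 3 := by simp [δ]

/-- An automorphism multiplies exponent sums by a sign. -/
lemma exists_len_map (φ : MulAut B4) : ∃ e : ℤ, (e = 1 ∨ e = -1) ∧ ∀ g, len (φ g) = e * len g := by
  have hb : len (φ b) = len (φ a) := by
    rw [← δ_a]; simp
  have hc : len (φ c) = len (φ a) := by
    rw [← hb, ← δ_b]; simp
  let H : Subgroup B4 :=
    { carrier := {g | len (φ g) = len (φ a) * len g}
      one_mem' := by simp
      mul_mem' := by
        intro g h hg hh
        change len _ = _ at hg hh ⊢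
        rw [map_mul, len_mul, hg, hh, len_mul]
        ring
      inv_mem' := by
        intro g hg
        change len _ = _ at hg ⊢
        rw [map_inv, len_inv, hg, len_inv]
        ring }
  have hlen : ∀ g, len (φ g) = len (φ a) * len g :=
    mem_of_generators_mem H (by simp [H]) (by simp [H, hb]) (by simp [H, hc])
  refine ⟨len (φ a), ?_, hlen⟩
  obtain ⟨g, hg⟩ := φ.surjective a
  have := hlen g
  rw [hg, len_a] at this
  exact Int.eq_one_or_neg_one_of_mul_eq_one this.symm

lemma commute_sq_of_commute_pow_four {M : Matrix.SpecialLinearGroup (Fin 2) ℤ}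
    (hA : Commute (M ^ 4) matA) (hB : Commute (M ^ 4) matB)
    (X : Matrix.SpecialLinearGroup (Fin 2) ℤ) : Commute (M ^ 2) X := by
  have hdet := M.det_coe
  rw [Matrix.det_fin_two] at hdet
  have hA' := congrArg Subtype.val hA.eq
  have hB' := congrArg Subtype.val hB.eq
  apply Subtype.ext
  simp only [Matrix.SpecialLinearGroup.coe_mul, Matrix.SpecialLinearGroup.coe_pow, coe_matA,
    coe_matB] at *
  generalize (M : Matrix (Fin 2) (Fin 2) ℤ) = N at *
  generalize (X : Matrix (Fin 2) (Fin 2) ℤ) = Y at *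
  obtain ⟨p, q, r, s, rfl⟩ : ∃ p q r s, N = !![p, q; r, s] := ⟨_, _, _, _, N.eta_fin_two⟩
  obtain ⟨p', q', r', s', rfl⟩ : ∃ p q r s, Y = !![p, q; r, s] := ⟨_, _, _, _, Y.eta_fin_two⟩
  have h₁ := congrFun (congrFun hA' 0) 0
  have h₂ := congrFun (congrFun hA' 0) 1
  have h₃ := congrFun (congrFun hB' 0) 0
  simp [pow_succ] at h₁ h₂ h₃ hdet
  have ht (z : ℤ) (h : (p + s) * ((p + s) ^ 2 - 2) * z = 0) : (p + s) * z = 0 := by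
    rcases mul_eq_zero.1 h with h | h
    · rcases mul_eq_zero.1 h with h | h
      · rw [h, zero_mul]
      · exfalso
        generalize p + s = t at h
        have : t < 2 := by nlinarith
        have : -2 < t := by nlinarith
        interval_cases t <;> omega
    · rw [h, mul_zero]
  have hq : (p + s) * q = 0 := ht q (by linear_combination h₃ + 2 * (p + s) * q * hdet)
  have hr : (p + s) * r = 0 := ht r (by linear_combination -h₁ + 2 * (p + s) * r * hdet)
  have hps : (p + s) * (p - s) = 0 := ht _ (by
    linear_combination -h₂ + 2 * (p + s) * (p - s) * hdet)
  ext i j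
  fin_cases i <;> fin_cases j <;> simp [pow_succ]
  · linear_combination r' * hq - q' * hr
  · linear_combination (s' - p') * hq + q' * hps
  · linear_combination (p' - s') * hr - r' * hps
  · linear_combination q' * hr - r' * hq

lemma δ_sq_a : δ ^ 2 * a * (δ ^ 2)⁻¹ = c := by
  calc δ ^ 2 * a * (δ ^ 2)⁻¹ = δ * (δ * a * δ⁻¹) * δ⁻¹ := by rw [pow_two]; group
    _ = c := by rw [δ_a, δ_b]

lemma rep_map_incl (φ : MulAut B4) (w : F2) : rep (φ (incl w)) = 1 := by
  have hcomm (g : B4) : Commute (rep (φ δ) ^ 4) (rep g) := by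
    obtain ⟨g, rfl⟩ := φ.surjective g
    simpa only [map_pow] using ((commute_δ_pow_four g).map φ).map rep
  have hac : rep (φ c) = rep (φ a) := by
    rw [← δ_sq_a, map_mul, map_mul, map_inv, map_mul, map_mul, map_inv, map_pow, map_pow,
      mul_inv_eq_iff_eq_mul]
    exact (commute_sq_of_commute_pow_four (by simpa using hcomm a) (by simpa using hcomm b) _).eq
  refine DFunLike.congr_fun (hom_ext_F2 (f := (rep.comp φ.toMonoidHom).comp incl) (f' := 1) ?_ ?_) w
  · simp [hac]
  · simp [hac]

lemma exists_map_incl (φ : MulAut B4) (w : F2) : ∃ v, φ (incl w) = incl v := by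
  obtain ⟨e, -, he⟩ := exists_len_map φ
  exact exists_eq_incl_of_len (rep_map_incl φ w) (Or.inl (by rw [he, len_incl, mul_zero]))

/-! ### Automorphisms and their linear parts -/

/-- The automorphism `φ` of the braid group restricts to an endomorphism of the free subgroup,
with matrix `M` on the abelianization. -/
def HasLinearPart (φ : MulAut B4) (M : Matrix (Fin 2) (Fin 2) ℤ) : Prop :=
  ∃ α : F2 →* F2, (∀ w, φ (incl w) = incl (α w)) ∧ ∀ w, ab (α w) = M.mulVec (ab w)

lemma exists_hasLinearPart (φ : MulAut B4) : ∃ M, HasLinearPart φ M := by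
  choose f hf using exists_map_incl φ
  let α : F2 →* F2 := MonoidHom.mk' f fun v w => incl_injective (by
    rw [map_mul, ← hf, ← hf, ← hf, map_mul, map_mul])
  refine ⟨!![ab (α x) 0, ab (α y) 0; ab (α x) 1, ab (α y) 1], α, hf, ab_map α _ ?_ ?_⟩ <;>
    ext i <;> fin_cases i <;> simp

lemma HasLinearPart.mul {φ ψ : MulAut B4} {M N : Matrix (Fin 2) (Fin 2) ℤ}
    (hφ : HasLinearPart φ M) (hψ : HasLinearPart ψ N) : HasLinearPart (φ * ψ) (M * N) := by
  obtain ⟨α, hα, hM⟩ := hφ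
  obtain ⟨β, hβ, hN⟩ := hψ
  exact ⟨α.comp β, fun w => by simp [hα, hβ], fun w => by
    rw [MonoidHom.comp_apply, hM, hN, Matrix.mulVec_mulVec]⟩

lemma HasLinearPart.eq {φ : MulAut B4} {M N : Matrix (Fin 2) (Fin 2) ℤ}
    (hM : HasLinearPart φ M) (hN : HasLinearPart φ N) : M = N := by
  obtain ⟨α, hα, hM⟩ := hM
  obtain ⟨β, hβ, hN⟩ := hN
  have key (w : F2) : M.mulVec (ab w) = N.mulVec (ab w) := by
    rw [← hM, ← hN, incl_injective ((hα w).symm.trans (hβ w))]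
  exact mulVec_ext (key x) (key y)

lemma hasLinearPart_conj (g : B4) : HasLinearPart (MulAut.conj g) (rep g) :=
  ⟨(act g).toMonoidHom, fun w => conj_incl g w, fun w => ab_act g w⟩

lemma HasLinearPart.det_eq {φ : MulAut B4} {M : Matrix (Fin 2) (Fin 2) ℤ}
    (h : HasLinearPart φ M) : M.det = 1 ∨ M.det = -1 := by
  obtain ⟨N, hN⟩ := exists_hasLinearPart φ⁻¹
  have h₁ := hasLinearPart_conj 1
  rw [map_one, map_one, ← mul_inv_cancel φ] at h₁
  have := congrArg Matrix.det ((h.mul hN).eq h₁)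
  rw [Matrix.det_mul, Matrix.SpecialLinearGroup.det_coe] at this
  exact Int.eq_one_or_neg_one_of_mul_eq_one this

section Unipotent

variable {φ : MulAut B4} {α : F2 →* F2}

lemma map_act (hα : ∀ w, φ (incl w) = incl (α w)) (g : B4) (w : F2) :
    α (act g w) = act (φ g) (α w) := by
  apply incl_injective
  rw [← hα, ← conj_incl, ← conj_incl, ← hα, map_mul, map_mul, map_inv]

lemma rep_map (hα : ∀ w, φ (incl w) = incl (α w)) (hab : ∀ w, ab (α w) = ab w) (g : B4) :
    rep (φ g) = rep g := by
  have key (w : F2) : (rep (φ g) : Matrix (Fin 2) (Fin 2) ℤ).mulVec (ab w) =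
      (rep g : Matrix (Fin 2) (Fin 2) ℤ).mulVec (ab w) := by
    rw [← ab_act g, ← hab w, ← ab_act, ← map_act hα, hab]
  exact Subtype.ext (mulVec_ext (key x) (key y))

lemma eq_x_of_norm_eq_one {g : F2} (hg : g.norm = 1) (hab : ab g = ab x) : g = x := by
  obtain ⟨⟨i, s⟩, hl⟩ := List.length_eq_one_iff.1 hg
  rw [← FreeGroup.mk_toWord (x := g), hl] at hab ⊢
  have h₀ := congrFun hab 0
  cases i <;> cases s
  · have : ab x⁻¹ 0 = ab x 0 := h₀
    simp at this
  · rfl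
  · have : ab y⁻¹ 0 = ab x 0 := h₀
    simp at this
  · have : ab y 0 = ab x 0 := h₀
    simp at this

lemma eq_one_of_map_δ (hα : ∀ w, φ (incl w) = incl (α w)) (hab : ∀ w, ab (α w) = ab w)
    (hδ : φ δ = δ) : φ = 1 := by
  have hrot (w : F2) : α (rot w) = rot (α w) := by
    rw [← act_δ, map_act hα, hδ, act_δ]
  have hsurj : Function.Surjective α := fun v => by
    obtain ⟨w, hw⟩ := exists_map_incl φ⁻¹ v
    refine ⟨w, incl_injective ?_⟩
    rw [← hα, ← hw, MulAut.apply_inv_self]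
  have hy : α y = rot (α x) := by rw [← hrot, rot_x]
  have hx : α x = x := by
    refine eq_x_of_norm_eq_one (norm_eq_one_of_surjective ?_ rfl hy hsurj) (hab x)
    rw [← hrot, ← hrot, rot_x, rot_y, map_inv]
  have hid : α = MonoidHom.id F2 := hom_ext_F2 hx (by rw [hy, hx, rot_x, MonoidHom.id_apply])
  obtain ⟨e, -, he⟩ := exists_len_map φ
  obtain rfl : e = 1 := by
    have := he δ
    rw [hδ, len_δ] at this
    omega
  ext g
  refine eq_of_act_eq ?_ (by rw [he, one_mul, MulAut.one_apply])
  ext w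
  simpa [hid] using (map_act hα g w).symm

lemma exists_map_δ_eq (hα : ∀ w, φ (incl w) = incl (α w)) (hab : ∀ w, ab (α w) = ab w) :
    ∃ w, φ δ = incl w⁻¹ * δ * incl w := by
  obtain ⟨n, hn⟩ : ∃ n, φ δ * δ⁻¹ = incl n := by
    obtain ⟨e, he', he⟩ := exists_len_map φ
    refine exists_eq_incl_of_len (by rw [map_mul, rep_map hα hab, ← map_mul, mul_inv_cancel,
      map_one]) ?_
    rw [len_mul, he, len_inv, len_δ]
    omega
  rw [mul_inv_eq_iff_eq_mul] at hn
  have hconj (w : F2) : δ * incl w = incl (rot w) * δ := by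
    rw [← act_δ, ← conj_incl, inv_mul_cancel_right]
  have hpow : φ (δ ^ 4) = incl (n * rot n * rot (rot n) * rot (rot (rot n))) * δ ^ 4 := by
    have hrot (w : F2) : incl (rot w) = δ * incl w * δ⁻¹ := by
      rw [hconj, mul_inv_cancel_right]
    rw [map_pow, hn]
    simp only [map_mul, hrot, pow_succ]
    group
  obtain ⟨w, rfl⟩ := exists_eq_inv_mul_rot n <| eq_one_of_forall_commute fun v => by
    generalize n * rot n * rot (rot n) * rot (rot (rot n)) = m at hpow
    have h := conj_incl (φ (δ ^ 4)) v
    have hcomm : Commute (φ (δ ^ 4)) (incl v) := by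
      obtain ⟨g, hg⟩ := φ.surjective (incl v)
      rw [← hg]
      exact (commute_δ_pow_four g).map φ
    rw [hcomm.eq, mul_inv_cancel_right, hpow, map_mul, act_δ_pow_four, mul_one, act_incl,
      MulAut.conj_apply] at h
    exact (eq_mul_inv_iff_mul_eq.1 (incl_injective h))
  exact ⟨w, by rw [hn, map_mul, mul_assoc, mul_assoc, hconj]⟩

lemma mem_range_conj_of_ab_eq (hα : ∀ w, φ (incl w) = incl (α w)) (hab : ∀ w, ab (α w) = ab w) :
    φ ∈ (MulAut.conj : B4 →* MulAut B4).range := by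
  obtain ⟨w, hw⟩ := exists_map_δ_eq hα hab
  have := eq_one_of_map_δ (φ := MulAut.conj (incl w) * φ)
    (α := (MulAut.conj w).toMonoidHom.comp α) (by simp [hα]) (by simp [hab])
    (by simp [hw, mul_assoc])
  rw [mul_eq_one_iff_eq_inv'] at this
  rw [this]
  exact inv_mem ⟨_, rfl⟩

end Unipotent

lemma rep_surjective : Function.Surjective rep := by
  rw [← MonoidHom.range_eq_top, eq_top_iff, ← SpecialLinearGroup.SL2Z_generators,
    Subgroup.closure_le]
  rintro _ (rfl | rfl)
  · refine ⟨a * b * a, Subtype.ext ?_⟩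
    simp [coe_matA, coe_matB, ModularGroup.coe_S]
  · refine ⟨a⁻¹, Subtype.ext ?_⟩
    simp [coe_matA, ModularGroup.coe_T, Matrix.adjugate_fin_two]

lemma HasLinearPart.mem_range_conj {φ : MulAut B4} {M : Matrix (Fin 2) (Fin 2) ℤ}
    (h : HasLinearPart φ M) (hdet : M.det = 1) : φ ∈ (MulAut.conj : B4 →* MulAut B4).range := by
  obtain ⟨g, hg⟩ := rep_surjective ⟨M, hdet⟩
  obtain ⟨α, hα, hM⟩ := (hasLinearPart_conj g⁻¹).mul h
  have hone : (rep g⁻¹ : Matrix (Fin 2) (Fin 2) ℤ) * M = 1 := by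
    have : M = (rep g : Matrix (Fin 2) (Fin 2) ℤ) := by rw [hg]
    rw [this, ← Matrix.SpecialLinearGroup.coe_mul, ← map_mul, inv_mul_cancel, map_one,
      Matrix.SpecialLinearGroup.coe_one]
  have := mem_range_conj_of_ab_eq hα fun w => by rw [hM, hone, Matrix.one_mulVec]
  exact (Subgroup.mul_mem_cancel_left _ (MonoidHom.mem_range.2 ⟨g⁻¹, rfl⟩)).1 this

/-! ### The inversion of the generators -/

lemma inv_braid {G : Type*} [Group G] {A B : G} (h : A * B * A = B * A * B) :
    A⁻¹ * B⁻¹ * A⁻¹ = B⁻¹ * A⁻¹ * B⁻¹ := by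
  simpa [mul_assoc] using congrArg (·⁻¹) h

/-- The endomorphism inverting every generator. -/
def mirrorHom : B4 →* B4 :=
  lift a⁻¹ b⁻¹ c⁻¹ (inv_braid braid_ab) (inv_braid braid_bc)
    (by rw [← mul_inv_rev, ← braid_ac, mul_inv_rev])

lemma mirrorHom_comp_mirrorHom : mirrorHom.comp mirrorHom = MonoidHom.id B4 :=
  hom_ext (by simp [mirrorHom]) (by simp [mirrorHom]) (by simp [mirrorHom])

/-- The automorphism inverting every generator. -/
def mirror : MulAut B4 :=
  MonoidHom.toMulEquiv mirrorHom mirrorHom mirrorHom_comp_mirrorHom mirrorHom_comp_mirrorHom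

@[simp] lemma mirror_a : mirror a = a⁻¹ := by
  simp [mirror, mirrorHom]
@[simp] lemma mirror_b : mirror b = b⁻¹ := by
  simp [mirror, mirrorHom]
@[simp] lemma mirror_c : mirror c = c⁻¹ := by
  simp [mirror, mirrorHom]

lemma mirror_notMem_range_conj : mirror ∉ (MulAut.conj : B4 →* MulAut B4).range := by
  rintro ⟨g, hg⟩
  have := congrArg len (DFunLike.congr_fun hg a)
  simp at this

lemma HasLinearPart.det_mirror {M : Matrix (Fin 2) (Fin 2) ℤ} (h : HasLinearPart mirror M) :
    M.det = -1 := by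
  obtain ⟨α, hα, hM⟩ := h
  have hx : α x = x⁻¹ := by
    apply incl_injective
    rw [← hα, incl_x, map_mul, map_inv, mirror_a, mirror_c, inv_inv, map_inv, incl_x, inv_a_mul_c]
    group
  have hy : α y = act (a⁻¹ * b⁻¹ * c⁻¹) x⁻¹ := by
    rw [← rot_x, ← act_δ, map_act hα, hx, δ, map_mul mirror, map_mul mirror, mirror_a,
      mirror_b, mirror_c]
  have h₀ := hM x
  have h₁ := hM y
  rw [hx] at h₀
  rw [hy, ab_act] at h₁
  have e₀ := congrFun h₀
  have e₁ := congrFun h₁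
  simp [Fin.forall_fin_two, Matrix.mulVec, dotProduct, coe_matA, coe_matB,
    Matrix.adjugate_fin_two] at e₀ e₁
  rw [Matrix.det_fin_two, ← e₀.1, ← e₀.2, ← e₁.1, ← e₁.2]
  norm_num

end BraidFour

/-- The inner automorphism group `Inn(B₄)`, the range of the conjugation
homomorphism `B₄ → Aut(B₄)`, is a subgroup of index 2 in `Aut(B₄)`. -/
theorem innB4_index_two :
    (MulAut.conj : B4 →* MulAut B4).range.index = 2 := by
  refine Subgroup.index_eq_two_iff_exists_notMem_and.2
    ⟨BraidFour.mirror, BraidFour.mirror_notMem_range_conj, fun φ => ?_⟩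
  obtain ⟨M, hM⟩ := BraidFour.exists_hasLinearPart φ
  obtain ⟨N, hN⟩ := BraidFour.exists_hasLinearPart BraidFour.mirror
  rcases hM.det_eq with h | h
  · exact Or.inr (hM.mem_range_conj h)
  · refine Or.inl ((hM.mul hN).mem_range_conj ?_)
    rw [Matrix.det_mul, h, hN.det_mirror]
    norm_num
end
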